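/- Let m, n ≥ 2, d ≥ 1, and 1 ≤ r ≤ min{m,n}−1 be integers. For every M ∈ POL_{d,m×n} of normal rank at most r there exists an integer a with 0 ≤ a ≤ rd such that closure({P ∈ POL_{d,m×n} : C¹_P is strictly equivalent to C¹_M}) ⊆ closure(O_a), where both closures are taken in the metric space POL_{d,m×n}. -/

import Mathlib

open Matrix Finset

namespace MPoly

/-- The space `POL_{d,m×n}` of `m × n` complex matrix polynomials of grade `d`,
identified with the tuple of coefficients `(A_0, …, A_d)`. -/
abbrev Pol (d m n : ℕ) := Fin (d+1) → Matrix (Fin m) (Fin n) ℂ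

/-- A matrix pencil `λ A + B` of size `p × q`, identified with the pair `(A, B)`. -/
abbrev Pencil (p q : ℕ) := Matrix (Fin p) (Fin q) ℂ × Matrix (Fin p) (Fin q) ℂ

/-- The metric on `POL_{d,m×n}`:  `dist(P,P') = (Σ_i ‖A_i − A'_i‖_F²)^(1/2)`. -/
noncomputable def polDist {m n d : ℕ} (P P' : Pol d m n) : ℝ :=
  Real.sqrt (∑ k, ∑ i, ∑ j, ‖P k i j - P' k i j‖ ^ 2)

/-- The Frobenius norm of a matrix polynomial: `‖P‖_F = (Σ_i ‖A_i‖_F²)^(1/2)`. -/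
noncomputable def polNorm {m n d : ℕ} (P : Pol d m n) : ℝ :=
  Real.sqrt (∑ k, ∑ i, ∑ j, ‖P k i j‖ ^ 2)

/-- The metric on pencils: `dist(λA+B, λA'+B') = (‖A−A'‖_F² + ‖B−B'‖_F²)^(1/2)`. -/
noncomputable def penDist {p q : ℕ} (L L' : Pencil p q) : ℝ :=
  Real.sqrt ((∑ i, ∑ j, ‖L.1 i j - L'.1 i j‖ ^ 2) + (∑ i, ∑ j, ‖L.2 i j - L'.2 i j‖ ^ 2))

/-- The `λ`-part `A = diag(A_d, I_n, …, I_n)` of the first companion form. -/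
noncomputable def compA (m n d : ℕ) (P : Pol d m n) :
    Matrix (Fin (m + n*(d-1))) (Fin (n*d)) ℂ := fun i j =>
  if hi : (i : ℕ) < m then
    if hj : (j : ℕ) < n then P (Fin.last d) ⟨i, hi⟩ ⟨j, hj⟩ else 0
  else if (i : ℕ) - m = (j : ℕ) - n ∧ n ≤ (j : ℕ) then 1 else 0

/-- The constant part `B` of the first companion form: first block row
`(A_{d-1}, …, A_0)`, with `−I_n` in block entries `(i+1, i)`. -/
noncomputable def compB (m n d : ℕ) (P : Pol d m n) :
    Matrix (Fin (m + n*(d-1))) (Fin (n*d)) ℂ := fun i j =>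
  if hi : (i : ℕ) < m then
    if hn : 0 < n then
      P ⟨d - 1 - (j : ℕ) / n, Nat.lt_succ_of_le ((Nat.sub_le _ _).trans (Nat.sub_le d 1))⟩ ⟨i, hi⟩ ⟨(j : ℕ) % n, Nat.mod_lt _ hn⟩
    else 0
  else if (j : ℕ) = (i : ℕ) - m then -1 else 0

/-- The first Frobenius companion form `C¹_P` of a matrix polynomial. -/
noncomputable def comp (m n d : ℕ) (P : Pol d m n) : Pencil (m + n*(d-1)) (n*d) :=
  (compA m n d P, compB m n d P)

/-- Strict equivalence of matrix pencils: `Q⁻¹ (λA+B) R = λC+D` for invertible `Q, R`. -/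
def StrictEquiv {p q : ℕ} (L M : Pencil p q) : Prop :=
  ∃ (Q : Matrix (Fin p) (Fin p) ℂ) (R : Matrix (Fin q) (Fin q) ℂ),
    IsUnit Q ∧ IsUnit R ∧ Q⁻¹ * L.1 * R = M.1 ∧ Q⁻¹ * L.2 * R = M.2

/-- The strict equivalence orbit of a pencil. -/
def orbE {p q : ℕ} (L : Pencil p q) : Set (Pencil p q) := {M | StrictEquiv L M}

/-- The generalized Sylvester space `GSYL¹_{d,m×n}` of all first companion forms. -/
def GSYL (m n d : ℕ) : Set (Pencil (m + n*(d-1)) (n*d)) := Set.range (comp m n d)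

/-- A matrix polynomial viewed as a matrix over the field `ℂ(λ)` of rational functions. -/
noncomputable def ratMatrix {m n d : ℕ} (P : Pol d m n) :
    Matrix (Fin m) (Fin n) (RatFunc ℂ) :=
  fun i j => ∑ k : Fin (d+1), RatFunc.C (P k i j) * RatFunc.X ^ (k : ℕ)

/-- The normal rank of a matrix polynomial: its rank over `ℂ(λ)`. -/
noncomputable def nrank {m n d : ℕ} (P : Pol d m n) : ℕ := (ratMatrix P).rank

/-- Offset of the `b`-th diagonal block when block `j` has size `sz j`. -/
def off (sz : ℕ → ℕ) (b : ℕ) : ℕ := ∑ j ∈ Finset.range b, sz j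

/-- The `p × q` matrix given as a direct sum of `N` diagonal blocks, where block `b`
has size `ρ b × γ b` and entries `ent b`, blocks being laid out along the diagonal
in order (block `b` occupies rows `[off ρ b, off ρ b + ρ b)` and columns
`[off γ b, off γ b + γ b)`); all other entries are zero. -/
noncomputable def dsum (N : ℕ) (ρ γ : ℕ → ℕ) (ent : ℕ → ℕ → ℕ → ℂ) (p q : ℕ) :
    Matrix (Fin p) (Fin q) ℂ := fun x y =>
  ∑ b ∈ Finset.range N,
    if off ρ b ≤ (x:ℕ) ∧ (x:ℕ) < off ρ b + ρ b ∧ off γ b ≤ (y:ℕ) ∧ (y:ℕ) < off γ b + γ b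
    then ent b ((x:ℕ) - off ρ b) ((y:ℕ) - off γ b) else 0

/-- Sizes of the four sections of blocks: `c₁` blocks of size `v₁`, then `c₂` of size
`v₂`, then `c₃` of size `v₃`, then the rest of size `v₄`. -/
def secSize (c₁ c₂ c₃ : ℕ) (v₁ v₂ v₃ v₄ : ℕ) (i : ℕ) : ℕ :=
  if i < c₁ then v₁ else if i < c₁ + c₂ then v₂ else if i < c₁ + c₂ + c₃ then v₃ else v₄

/-- The `p × q` pencil which is the direct sum of `c₁` copies of `L_{e₁}`, `c₂` copies
of `L_{e₂}`, `c₃` copies of `L_{f₁}ᵀ` and `c₄` copies of `L_{f₂}ᵀ`.  Here `L_k` is the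
`k × (k+1)` pencil `λ G_k + F_k` with `G_k` having ones in entries `(i,i)` and `F_k`
having ones in entries `(i,i+1)`. -/
noncomputable def genPencil (c₁ c₂ c₃ c₄ e₁ e₂ f₁ f₂ p q : ℕ) : Pencil p q :=
  (dsum (c₁+c₂+c₃+c₄) (secSize c₁ c₂ c₃ e₁ e₂ (f₁+1) (f₂+1))
     (secSize c₁ c₂ c₃ (e₁+1) (e₂+1) f₁ f₂)
     (fun _ i j => if i = j then 1 else 0) p q,
   dsum (c₁+c₂+c₃+c₄) (secSize c₁ c₂ c₃ e₁ e₂ (f₁+1) (f₂+1))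
     (secSize c₁ c₂ c₃ (e₁+1) (e₂+1) f₁ f₂)
     (fun b i j => if b < c₁ + c₂ then (if j = i+1 then 1 else 0)
       else (if i = j+1 then 1 else 0)) p q)

/-- The generic pencil `G_a` of Theorem 3.2 (viewed at grade `d`):  the direct sum of
`s` copies of `L_{α+d}`, `n−r−s` copies of `L_{α+d−1}`, `t` copies of `L_{β+1}ᵀ` and
`m−r−t` copies of `L_βᵀ`, where `α = ⌊a/(n−r)⌋`, `s = a mod (n−r)`,
`β = ⌊(rd−a)/(m−r)⌋`, `t = (rd−a) mod (m−r)`. -/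
noncomputable def Ga (m n d r a : ℕ) : Pencil (m + n*(d-1)) (n*d) :=
  genPencil (a % (n-r)) (n-r - a % (n-r)) ((r*d - a) % (m-r)) (m-r - (r*d - a) % (m-r))
    (a/(n-r) + d) (a/(n-r) + d - 1) ((r*d - a)/(m-r) + 1) ((r*d - a)/(m-r))
    (m + n*(d-1)) (n*d)


/-- The generic rank-`ρ` pencil of size `p × q` with parameter `b` (Theorem 3.2 of
De Terán–Dopico): direct sum of `s₁` copies of `L_{α₁+1}`, `q−ρ−s₁` copies of `L_{α₁}`,
`t₁` copies of `L_{β₁+1}ᵀ` and `p−ρ−t₁` copies of `L_{β₁}ᵀ`, where `α₁ = ⌊b/(q−ρ)⌋`,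
`s₁ = b mod (q−ρ)`, `β₁ = ⌊(ρ−b)/(p−ρ)⌋`, `t₁ = (ρ−b) mod (p−ρ)`. -/
noncomputable def Kp (p q ρ b : ℕ) : Pencil p q :=
  genPencil (b % (q-ρ)) (q-ρ - b % (q-ρ)) ((ρ-b) % (p-ρ)) (p-ρ - (ρ-b) % (p-ρ))
    (b/(q-ρ) + 1) (b/(q-ρ)) ((ρ-b)/(p-ρ) + 1) ((ρ-b)/(p-ρ)) p q

/-- The generic right-singular pencil `G_rp` (case `m < n`): direct sum of `s` copies of
`L_{α+d}` and `n−m−s` copies of `L_{α+d−1}`, with `α = ⌊md/(n−m)⌋`, `s = md mod (n−m)`. -/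
noncomputable def Grp (m n d : ℕ) : Pencil (m + n*(d-1)) (n*d) :=
  genPencil (m*d % (n-m)) (n-m - m*d % (n-m)) 0 0
    (m*d/(n-m) + d) (m*d/(n-m) + d - 1) 0 0 (m + n*(d-1)) (n*d)

/-- The generic left-singular pencil `G_ℓp` (case `m > n`): direct sum of `t` copies of
`L_{β+1}ᵀ` and `m−n−t` copies of `L_βᵀ`, with `β = ⌊nd/(m−n)⌋`, `t = nd mod (m−n)`. -/
noncomputable def Glp (m n d : ℕ) : Pencil (m + n*(d-1)) (n*d) :=
  genPencil 0 0 (n*d % (m-n)) (m-n - n*d % (m-n)) 0 0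
    (n*d/(m-n) + 1) (n*d/(m-n)) (m + n*(d-1)) (n*d)

/-- The linear map `(X, Y) ↦ (XA − AY, XB − BY)` whose range is the tangent space at
`λA+B` to the strict equivalence orbit of the pencil `λA+B`. -/
noncomputable def tangentMap {p q : ℕ} (L : Pencil p q) :
    (Matrix (Fin p) (Fin p) ℂ × Matrix (Fin q) (Fin q) ℂ) →ₗ[ℂ]
      (Matrix (Fin p) (Fin q) ℂ × Matrix (Fin p) (Fin q) ℂ) where
  toFun XY := (XY.1 * L.1 - L.1 * XY.2, XY.1 * L.2 - L.2 * XY.2)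
  map_add' X Y := by
    obtain ⟨X₁, X₂⟩ := X; obtain ⟨Y₁, Y₂⟩ := Y
    simp only [Prod.mk_add_mk, Matrix.add_mul, Matrix.mul_add, Prod.mk.injEq]
    constructor <;> abel
  map_smul' c X := by
    obtain ⟨X₁, X₂⟩ := X
    simp only [Prod.smul_mk, Matrix.smul_mul, Matrix.mul_smul, RingHom.id_apply,
      Prod.mk.injEq, smul_sub]

/-- The tangent space `T = {(XA − AY, XB − BY)}` at `λA+B` to its strict equivalence
orbit, as a subspace of the pencil space. -/
noncomputable def tangent {p q : ℕ} (L : Pencil p q) :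
    Submodule ℂ (Matrix (Fin p) (Fin q) ℂ × Matrix (Fin p) (Fin q) ℂ) :=
  LinearMap.range (tangentMap L)

/-- The first companion form `C¹_M(λ) = λ A + B` regarded as a matrix over `ℂ[λ]`. -/
noncomputable def compPoly (m n d : ℕ) (M : Pol d m n) :
    Matrix (Fin (m + n*(d-1))) (Fin (n*d)) (Polynomial ℂ) := fun i j =>
  Polynomial.C (compA m n d M i j) * Polynomial.X + Polynomial.C (compB m n d M i j)

/-- The block-diagonal matrix `diag(M(λ), I_{n(d−1)})` over `ℂ[λ]`. -/
noncomputable def polyBlock (m n d : ℕ) (M : Pol d m n) :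
    Matrix (Fin (m + n*(d-1))) (Fin (n*d)) (Polynomial ℂ) := fun i j =>
  if hi : (i : ℕ) < m then
    if hj : (j : ℕ) < n then
      ∑ k : Fin (d+1), Polynomial.C (M k ⟨i, hi⟩ ⟨j, hj⟩) * Polynomial.X ^ (k : ℕ)
    else 0
  else if (i : ℕ) - m = (j : ℕ) - n ∧ n ≤ (j : ℕ) then 1 else 0

/-- The first companion form regarded as a matrix over the field `ℂ(λ)`. -/
noncomputable def compRat (m n d : ℕ) (M : Pol d m n) :
    Matrix (Fin (m + n*(d-1))) (Fin (n*d)) (RatFunc ℂ) := fun i j =>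
  RatFunc.C (compA m n d M i j) * RatFunc.X + RatFunc.C (compB m n d M i j)


/-! ### Strict equivalence is an equivalence relation -/

lemma StrictEquiv.of_eq {p q : ℕ} {L M : Pencil p q} (P : Matrix (Fin p) (Fin p) ℂ)
    (Q : Matrix (Fin q) (Fin q) ℂ) (hP : IsUnit P) (hQ : IsUnit Q)
    (h1 : L.1 = P * M.1 * Q) (h2 : L.2 = P * M.2 * Q) : StrictEquiv L M := by
  have hPd := (Matrix.isUnit_iff_isUnit_det P).1 hP
  have hQd := (Matrix.isUnit_iff_isUnit_det Q).1 hQ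
  have key : ∀ A : Matrix (Fin p) (Fin q) ℂ, P⁻¹ * (P * A * Q) * Q⁻¹ = A := by
    intro A
    rw [Matrix.mul_assoc P A Q, ← Matrix.mul_assoc P⁻¹ P, Matrix.nonsing_inv_mul P hPd,
      Matrix.one_mul, Matrix.mul_assoc, Matrix.mul_nonsing_inv Q hQd, Matrix.mul_one]
  refine ⟨P, Q⁻¹, hP, ?_, ?_, ?_⟩
  · rwa [Matrix.isUnit_nonsing_inv_iff]
  · rw [h1, key]
  · rw [h2, key]

lemma StrictEquiv.exists_eq {p q : ℕ} {L M : Pencil p q} (h : StrictEquiv L M) :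
    ∃ (P : Matrix (Fin p) (Fin p) ℂ) (Q : Matrix (Fin q) (Fin q) ℂ), IsUnit P ∧ IsUnit Q ∧
      L.1 = P * M.1 * Q ∧ L.2 = P * M.2 * Q := by
  obtain ⟨P, Q, hP, hQ, h1, h2⟩ := h
  have hPd := (Matrix.isUnit_iff_isUnit_det P).1 hP
  have hQd := (Matrix.isUnit_iff_isUnit_det Q).1 hQ
  have key : ∀ A : Matrix (Fin p) (Fin q) ℂ, P * (P⁻¹ * A * Q) * Q⁻¹ = A := by
    intro A
    rw [Matrix.mul_assoc P⁻¹ A Q, ← Matrix.mul_assoc P P⁻¹, Matrix.mul_nonsing_inv P hPd,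
      Matrix.one_mul, Matrix.mul_assoc, Matrix.mul_nonsing_inv Q hQd, Matrix.mul_one]
  refine ⟨P, Q⁻¹, hP, ?_, ?_, ?_⟩
  · rwa [Matrix.isUnit_nonsing_inv_iff]
  · rw [← h1, key]
  · rw [← h2, key]

lemma StrictEquiv.rfl' {p q : ℕ} (L : Pencil p q) : StrictEquiv L L :=
  StrictEquiv.of_eq 1 1 isUnit_one isUnit_one (by simp) (by simp)

lemma StrictEquiv.symm' {p q : ℕ} {L M : Pencil p q} (h : StrictEquiv L M) :
    StrictEquiv M L := by
  obtain ⟨P, Q, hP, hQ, h1, h2⟩ := h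
  exact StrictEquiv.of_eq P⁻¹ Q (by rwa [Matrix.isUnit_nonsing_inv_iff]) hQ h1.symm h2.symm

lemma StrictEquiv.trans' {p q : ℕ} {L M N : Pencil p q} (h : StrictEquiv L M)
    (h' : StrictEquiv M N) : StrictEquiv L N := by
  obtain ⟨P, Q, hP, hQ, h1, h2⟩ := h.exists_eq
  obtain ⟨P', Q', hP', hQ', h1', h2'⟩ := h'.exists_eq
  refine StrictEquiv.of_eq (P * P') (Q' * Q) (hP.mul hP') (hQ'.mul hQ) ?_ ?_
  · rw [h1, h1']; simp only [Matrix.mul_assoc]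
  · rw [h2, h2']; simp only [Matrix.mul_assoc]

/-! ### Surjectivity through duality -/

lemma surj_of_dual {p q : ℕ} {V : Type*} [AddCommGroup V] [Module ℂ V]
    (T : V →ₗ[ℂ] Pencil p q)
    (h : ∀ D1 D0 : Fin p → Fin q → ℂ,
      (∀ v, ∑ x, ∑ y, (D1 x y * (T v).1 x y + D0 x y * (T v).2 x y) = 0) →
      (∀ x y, D1 x y = 0) ∧ (∀ x y, D0 x y = 0)) : Function.Surjective T := by
  rw [← LinearMap.range_eq_top]
  by_contra hne
  obtain ⟨f, hf0, hf⟩ := Submodule.exists_le_ker_of_lt_top _ (lt_top_iff_ne_top.2 hne)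
  have hexp : ∀ L : Pencil p q, f L = ∑ x, ∑ y, (f (Matrix.single x y 1, 0) * L.1 x y
      + f (0, Matrix.single x y 1) * L.2 x y) := by
    intro L
    have e : L = ∑ x, ∑ y, (L.1 x y • ((Matrix.single x y 1, 0) : Pencil p q)
        + L.2 x y • ((0, Matrix.single x y 1) : Pencil p q)) := by
      have e1 := Matrix.matrix_eq_sum_single L.1
      have e2 := Matrix.matrix_eq_sum_single L.2
      apply Prod.ext
      · simp only [Prod.fst_sum, Prod.fst_add, Prod.smul_fst, smul_zero, add_zero,
          Matrix.smul_single, smul_eq_mul, mul_one]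
        exact e1
      · simp only [Prod.snd_sum, Prod.snd_add, Prod.smul_snd, smul_zero, zero_add,
          Matrix.smul_single, smul_eq_mul, mul_one]
        exact e2
    conv_lhs => rw [e]
    simp only [map_sum, map_add, map_smul, smul_eq_mul, mul_comm]
  obtain ⟨h1, h0⟩ := h (fun x y => f (Matrix.single x y 1, 0))
    (fun x y => f (0, Matrix.single x y 1)) (fun v => by
      rw [← hexp]; exact hf ⟨v, rfl⟩)
  apply hf0
  refine LinearMap.ext fun L => ?_
  rw [hexp L, LinearMap.zero_apply]
  refine Finset.sum_eq_zero fun x _ => Finset.sum_eq_zero fun y _ => ?_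
  rw [h1 x y, h0 x y, zero_mul, zero_mul, add_zero]

/-! ### Submersion lemma -/

section
attribute [local instance] Matrix.normedAddCommGroup Matrix.normedSpace

lemma strict_mul {V : Type*} [NormedAddCommGroup V] [NormedSpace ℂ V] {a b c : ℕ}
    {f : V → Matrix (Fin a) (Fin b) ℂ} {g : V → Matrix (Fin b) (Fin c) ℂ}
    {f' : V →L[ℂ] Matrix (Fin a) (Fin b) ℂ} {g' : V →L[ℂ] Matrix (Fin b) (Fin c) ℂ} {v : V}
    (hf : HasStrictFDerivAt f f' v) (hg : HasStrictFDerivAt g g' v) :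
    ∃ h' : V →L[ℂ] Matrix (Fin a) (Fin c) ℂ,
      HasStrictFDerivAt (fun w => f w * g w) h' v ∧ ∀ w, h' w = f v * g' w + f' w * g v := by
  let B : Matrix (Fin a) (Fin b) ℂ →ₗ[ℂ] Matrix (Fin b) (Fin c) ℂ →ₗ[ℂ] Matrix (Fin a) (Fin c) ℂ :=
    LinearMap.mk₂ ℂ (fun X Y => X * Y) Matrix.add_mul (fun c X Y => Matrix.smul_mul c X Y)
      Matrix.mul_add (fun c X Y => Matrix.mul_smul X c Y)
  refine ⟨_, B.toContinuousBilinearMap.hasStrictFDerivAt_of_bilinear hf hg, ?_⟩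
  intro w
  rfl

lemma map_nhds_action {p q : ℕ} {V : Type*} [NormedAddCommGroup V] [NormedSpace ℂ V]
    [FiniteDimensional ℂ V] (L : Pencil p q)
    (x : V →ₗ[ℂ] Matrix (Fin p) (Fin p) ℂ) (y : V →ₗ[ℂ] Matrix (Fin q) (Fin q) ℂ)
    (c z : V →ₗ[ℂ] Pencil p q)
    (hs : ∀ D : Pencil p q, ∃ v, x v * L.1 + L.1 * y v + (c v).1 + (z v).1 = D.1 ∧
      x v * L.2 + L.2 * y v + (c v).2 + (z v).2 = D.2) :
    Filter.map (fun v => (((1 + x v) * (L.1 + (c v).1) * (1 + y v) + (z v).1,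
      (1 + x v) * (L.2 + (c v).2) * (1 + y v) + (z v).2) : Pencil p q)) (nhds 0) = nhds L := by
  have : CompleteSpace V := FiniteDimensional.complete ℂ V
  have lin : ∀ {F : Type} [NormedAddCommGroup F] [NormedSpace ℂ F] (k : F) (f : V →ₗ[ℂ] F),
      HasStrictFDerivAt (fun v => k + f v) (LinearMap.toContinuousLinearMap f) 0 := by
    intro F _ _ k f
    exact (LinearMap.toContinuousLinearMap f).hasStrictFDerivAt.const_add k
  have one : ∀ (A : Matrix (Fin p) (Fin q) ℂ) (c z : V →ₗ[ℂ] Matrix (Fin p) (Fin q) ℂ),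
      ∃ h' : V →L[ℂ] Matrix (Fin p) (Fin q) ℂ,
      HasStrictFDerivAt (fun v => (1 + x v) * (A + c v) * (1 + y v) + z v) h' 0 ∧
      ∀ v, h' v = x v * A + A * y v + c v + z v := by
    intro A c z
    obtain ⟨h1, hh1, e1⟩ := strict_mul (lin 1 x) (lin A c)
    obtain ⟨h2, hh2, e2⟩ := strict_mul hh1 (lin 1 y)
    refine ⟨_, hh2.add (LinearMap.toContinuousLinearMap z).hasStrictFDerivAt, ?_⟩
    intro v
    change h2 v + z v = _
    rw [e2, e1]
    simp only [map_zero, add_zero, Matrix.one_mul, Matrix.mul_one]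
    change A * y v + (c v + x v * A) + z v = _
    abel
  obtain ⟨h1, hh1, e1⟩ := one L.1 (LinearMap.fst ℂ _ _ ∘ₗ c) (LinearMap.fst ℂ _ _ ∘ₗ z)
  obtain ⟨h2, hh2, e2⟩ := one L.2 (LinearMap.snd ℂ _ _ ∘ₗ c) (LinearMap.snd ℂ _ _ ∘ₗ z)
  have := (hh1.prodMk hh2).map_nhds_eq_of_surj (by
    rw [LinearMap.range_eq_top]
    intro D
    obtain ⟨v, hv1, hv2⟩ := hs D
    refine ⟨v, ?_⟩
    apply Prod.ext
    · exact (e1 v).trans hv1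
    · exact (e2 v).trans hv2)
  exact this.trans (congrArg nhds (by simp))

end

lemma isUnit_one_add_eventually {p : ℕ} {V : Type*} [TopologicalSpace V] [AddCommGroup V]
    [Module ℂ V] (x : V →ₗ[ℂ] Matrix (Fin p) (Fin p) ℂ) (hx : Continuous x) :
    ∀ᶠ v in nhds (0 : V), IsUnit (1 + x v) := by
  have hc : Continuous (fun v => (1 + x v).det) := (continuous_const.add hx).matrix_det
  have : ∀ᶠ v in nhds (0 : V), (1 + x v).det ≠ 0 :=
    hc.continuousAt.eventually_ne (by simp)
  filter_upwards [this] with v hv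
  rw [Matrix.isUnit_iff_isUnit_det]
  exact isUnit_iff_ne_zero.2 hv

/-! ### Generic surjectivity along a line -/

lemma finite_not_surj {V F : Type*} [AddCommGroup V] [Module ℂ V] [AddCommGroup F] [Module ℂ F]
    [FiniteDimensional ℂ F] (A B : V →ₗ[ℂ] F) (t₁ : ℂ)
    (h : Function.Surjective (A + t₁ • B)) :
    {t : ℂ | ¬ Function.Surjective (A + t • B)}.Finite := by
  obtain ⟨S, hS⟩ := LinearMap.exists_rightInverse_of_surjective _ (LinearMap.range_eq_top.2 h)
  let bs := Module.finBasis ℂ F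
  let a := LinearMap.toMatrix bs bs (A ∘ₗ S)
  let b := LinearMap.toMatrix bs bs (B ∘ₗ S)
  let pl : Polynomial ℂ := (a.map Polynomial.C + (Polynomial.X : Polynomial ℂ) • b.map Polynomial.C).det
  have hev : ∀ t, pl.eval t = LinearMap.det ((A + t • B) ∘ₗ S) := by
    intro t
    rw [← LinearMap.det_toMatrix bs]
    have e : LinearMap.toMatrix bs bs ((A + t • B) ∘ₗ S) = a + t • b := by
      rw [LinearMap.add_comp, LinearMap.smul_comp, map_add, map_smul]
    rw [e]
    change (Polynomial.evalRingHom t) _ = _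
    rw [RingHom.map_det]
    congr 1
    ext i j
    simp [RingHom.mapMatrix_apply]
    ring
  have hne : pl ≠ 0 := by
    intro h0
    have := hev t₁
    rw [h0, hS] at this
    simp at this
  refine (pl.roots.toFinset.finite_toSet).subset ?_
  intro t ht
  simp only [Finset.mem_coe, Multiset.mem_toFinset, Polynomial.mem_roots hne, Polynomial.IsRoot]
  by_contra h0
  apply ht
  rw [hev] at h0
  have hu : IsUnit (LinearMap.det ((A + t • B) ∘ₗ S)) := isUnit_iff_ne_zero.2 h0
  have hb := (LinearEquiv.ofIsUnitDet (f := (A + t • B) ∘ₗ S) (v := bs) (v' := bs) (by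
    rw [LinearMap.det_toMatrix]; exact hu))
  have hsurj : Function.Surjective ((A + t • B) ∘ₗ S) := by
    have h3 : IsUnit ((A + t • B) ∘ₗ S) := by
      rw [LinearMap.isUnit_iff_isUnit_det]; exact hu
    exact ((Module.End.isUnit_iff _).1 h3).2
  intro y
  obtain ⟨w, hw⟩ := hsurj y
  exact ⟨S w, hw⟩

/-! ### Density of the orbit in a compression space -/

/-- keep the entries satisfying a predicate -/
noncomputable def keep {a b : ℕ} (pr : Fin a → Fin b → Prop) :
    Matrix (Fin a) (Fin b) ℂ →ₗ[ℂ] Matrix (Fin a) (Fin b) ℂ where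
  toFun X := by classical exact Matrix.of fun i j => if pr i j then X i j else 0
  map_add' X Y := by
    ext i j; simp only [Matrix.of_apply, Matrix.add_apply]; split_ifs <;> simp
  map_smul' c X := by
    ext i j; simp only [Matrix.of_apply, Matrix.smul_apply]; split_ifs <;> simp

open Classical in
lemma keep_apply {a b : ℕ} (pr : Fin a → Fin b → Prop) (X : Matrix (Fin a) (Fin b) ℂ) (i j) :
    keep pr X i j = if pr i j then X i j else 0 := by
  simp only [keep, LinearMap.coe_mk, AddHom.coe_mk, Matrix.of_apply]

/-- The pencils vanishing at positions (row `≥ b`, column `< c`). -/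
def InE {p q : ℕ} (b c : ℕ) (L : Pencil p q) : Prop :=
  ∀ (x : Fin p) (y : Fin q), b ≤ (x : ℕ) → (y : ℕ) < c → L.1 x y = 0 ∧ L.2 x y = 0

/-- Parameter space for infinitesimal block-triangular equivalences. -/
abbrev Par (p q : ℕ) := (Matrix (Fin p) (Fin p) ℂ × Matrix (Fin q) (Fin q) ℂ) × Pencil p q

noncomputable def parX (p q b : ℕ) : Par p q →ₗ[ℂ] Matrix (Fin p) (Fin p) ℂ :=
  keep (fun i j => ¬ (b ≤ (i : ℕ) ∧ (j : ℕ) < b)) ∘ₗ LinearMap.fst ℂ _ _ ∘ₗ LinearMap.fst ℂ _ _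

noncomputable def parY (p q c : ℕ) : Par p q →ₗ[ℂ] Matrix (Fin q) (Fin q) ℂ :=
  keep (fun i j => ¬ (c ≤ (i : ℕ) ∧ (j : ℕ) < c)) ∘ₗ LinearMap.snd ℂ _ _ ∘ₗ LinearMap.fst ℂ _ _

noncomputable def parZ (p q b c : ℕ) : Par p q →ₗ[ℂ] Pencil p q :=
  (LinearMap.prodMap (keep (fun i j => (b ≤ (i : ℕ) ∧ (j : ℕ) < c)))
    (keep (fun i j => (b ≤ (i : ℕ) ∧ (j : ℕ) < c)))) ∘ₗ LinearMap.snd ℂ _ _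

/-- The linear part (in `L`) of the tangent map. -/
noncomputable def tanL {p q : ℕ} (b c : ℕ) (L : Pencil p q) : Par p q →ₗ[ℂ] Pencil p q where
  toFun v := (parX p q b v * L.1 + L.1 * parY p q c v, parX p q b v * L.2 + L.2 * parY p q c v)
  map_add' v w := by
    apply Prod.ext <;> simp only [map_add, Matrix.add_mul, Matrix.mul_add, Prod.fst_add,
      Prod.snd_add] <;> abel
  map_smul' k v := by
    apply Prod.ext <;> simp only [map_smul, Matrix.smul_mul, Matrix.mul_smul, Prod.smul_fst,
      Prod.smul_snd, smul_add, RingHom.id_apply]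

noncomputable def tanE {p q : ℕ} (b c : ℕ) (L : Pencil p q) : Par p q →ₗ[ℂ] Pencil p q :=
  tanL b c L + parZ p q b c

lemma inE_act {p q b c : ℕ} {L : Pencil p q} (hL : InE b c L) (v : Par p q) :
    InE b c (((1 + parX p q b v) * L.1 * (1 + parY p q c v),
      (1 + parX p q b v) * L.2 * (1 + parY p q c v)) : Pencil p q) := by
  have key : ∀ A : Matrix (Fin p) (Fin q) ℂ,
      (∀ (x : Fin p) (y : Fin q), b ≤ (x : ℕ) → (y : ℕ) < c → A x y = 0) →
      ∀ (x : Fin p) (y : Fin q), b ≤ (x : ℕ) → (y : ℕ) < c →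
      ((1 + parX p q b v) * A * (1 + parY p q c v) : Matrix (Fin p) (Fin q) ℂ) x y = 0 := by
    intro A hA x y hx hy
    rw [Matrix.mul_apply]
    refine Finset.sum_eq_zero fun y' _ => ?_
    by_cases hy' : (y' : ℕ) < c
    · have : ((1 + parX p q b v) * A : Matrix (Fin p) (Fin q) ℂ) x y' = 0 := by
        rw [Matrix.mul_apply]
        refine Finset.sum_eq_zero fun x' _ => ?_
        by_cases hx' : b ≤ (x' : ℕ)
        · rw [hA x' y' hx' hy', mul_zero]
        · have h1 : x ≠ x' := by rintro rfl; exact hx' hx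
          have : (1 + parX p q b v) x x' = 0 := by
            rw [Matrix.add_apply, Matrix.one_apply_ne h1]
            simp only [parX, LinearMap.comp_apply, keep_apply]
            rw [if_neg, add_zero]
            push Not
            exact ⟨hx, by omega⟩
          rw [this, zero_mul]
      rw [this, zero_mul]
    · have h1 : y' ≠ y := by rintro rfl; exact hy' hy
      have : (1 + parY p q c v) y' y = 0 := by
        rw [Matrix.add_apply, Matrix.one_apply_ne h1]
        simp only [parY, LinearMap.comp_apply, keep_apply]
        rw [if_neg, add_zero]
        push Not
        exact ⟨by omega, hy⟩
      rw [this, mul_zero]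
  intro x y hx hy
  exact ⟨key _ (fun x y hx hy => (hL x y hx hy).1) x y hx hy,
    key _ (fun x y hx hy => (hL x y hx hy).2) x y hx hy⟩

section
attribute [local instance] Matrix.normedAddCommGroup Matrix.normedSpace

lemma open_orbit {p q b c : ℕ} {L : Pencil p q} (hL : InE b c L)
    (hs : Function.Surjective (tanE b c L)) :
    ∀ᶠ L' in nhds L, InE b c L' → StrictEquiv L' L := by
  have hmap := map_nhds_action L (parX p q b) (parY p q c) 0 (parZ p q b c) (by
    intro D
    obtain ⟨v, hv⟩ := hs D
    refine ⟨v, ?_, ?_⟩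
    · rw [← hv]; simp [tanE, tanL]
    · rw [← hv]; simp [tanE, tanL])
  rw [← hmap, Filter.eventually_map]
  filter_upwards [isUnit_one_add_eventually (parX p q b) (LinearMap.continuous_of_finiteDimensional _),
    isUnit_one_add_eventually (parY p q c) (LinearMap.continuous_of_finiteDimensional _)] with v hX hY hE
  have hact := inE_act hL v
  have hz : ∀ A B : Matrix (Fin p) (Fin q) ℂ,
      (∀ (x : Fin p) (y : Fin q), b ≤ (x : ℕ) → (y : ℕ) < c → A x y = 0) →
      (∀ (x : Fin p) (y : Fin q), b ≤ (x : ℕ) → (y : ℕ) < c →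
        (A + keep (fun i j => (b ≤ (i : ℕ) ∧ (j : ℕ) < c)) B) x y = 0) →
      A + keep (fun i j => (b ≤ (i : ℕ) ∧ (j : ℕ) < c)) B = A := by
    intro A B hA hAB
    ext x y
    by_cases hxy : b ≤ (x : ℕ) ∧ (y : ℕ) < c
    · rw [hAB x y hxy.1 hxy.2, hA x y hxy.1 hxy.2]
    · rw [Matrix.add_apply, keep_apply, if_neg hxy, add_zero]
  simp only [LinearMap.zero_apply, Prod.fst_zero, Prod.snd_zero, add_zero] at hE ⊢
  refine StrictEquiv.of_eq _ _ hX hY ?_ ?_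
  · exact hz _ v.2.1 (fun x y hx hy => (hact x y hx hy).1) (fun x y hx hy => (hE x y hx hy).1)
  · exact hz _ v.2.2 (fun x y hx hy => (hact x y hx hy).2) (fun x y hx hy => (hE x y hx hy).2)

end

lemma dense_orbit {p q b c : ℕ} {K L : Pencil p q} (hK : InE b c K) (hL : InE b c L)
    (hs : Function.Surjective (tanE b c K)) :
    L ∈ closure {L' : Pencil p q | StrictEquiv L' K} := by
  let e : ℂ → Pencil p q := fun t => L + t • (K - L)
  have he : Continuous e := by fun_prop
  have heE : ∀ t, InE b c (e t) := by
    intro t x y hx hy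
    simp [e, hL x y hx hy, hK x y hx hy]
  have htan : ∀ t, tanE b c (e t) = tanE b c L + t • (tanL b c (K - L)) := by
    intro t
    refine LinearMap.ext fun v => ?_
    apply Prod.ext
    · simp only [tanE, tanL, e, LinearMap.add_apply, LinearMap.smul_apply, LinearMap.coe_mk,
        AddHom.coe_mk, Prod.fst_add, Prod.smul_fst, Matrix.mul_add, Matrix.add_mul,
        Matrix.mul_smul, Matrix.smul_mul, smul_add]
      abel
    · simp only [tanE, tanL, e, LinearMap.add_apply, LinearMap.smul_apply, LinearMap.coe_mk,
        AddHom.coe_mk, Prod.snd_add, Prod.smul_snd, Matrix.mul_add, Matrix.add_mul,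
        Matrix.mul_smul, Matrix.smul_mul, smul_add]
      abel
  have he1 : e 1 = K := by simp [e]
  have hfin := finite_not_surj (tanE b c L) (tanL b c (K - L)) 1 (by rw [← htan, he1]; exact hs)
  set S : Set ℂ := {t : ℂ | ¬ Function.Surjective (tanE b c L + t • tanL b c (K - L))} with hS
  have hconn : IsPreconnected Sᶜ :=
    (hfin.countable.isConnected_compl_of_one_lt_rank (by
      rw [Complex.rank_real_complex]; norm_num)).isPreconnected
  have h1S : (1 : ℂ) ∈ Sᶜ := by
    simp only [hS, Set.mem_compl_iff, Set.mem_ofPred_eq, not_not]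
    rw [← htan, he1]; exact hs
  have hall : ∀ t ∈ Sᶜ, StrictEquiv (e t) K := by
    intro t ht
    rw [← he1]
    refine hconn.induction₂ (fun s t => StrictEquiv (e s) (e t)) ?_ ?_ ?_ ht h1S
    · intro s hs'
      have hss : Function.Surjective (tanE b c (e s)) := by
        rw [htan]; simpa [hS] using hs'
      have := he.continuousAt.eventually (open_orbit (heE s) hss)
      refine Filter.Eventually.filter_mono nhdsWithin_le_nhds ?_
      filter_upwards [this] with t ht
      exact (ht (heE t)).symm'
    · intro x y z _ _ _ h h'; exact h.trans' h'
    · intro x y _ _ h; exact h.symm'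
  have hdense : Dense Sᶜ := hfin.countable.dense_compl ℂ
  have h0 : (0 : ℂ) ∈ closure Sᶜ := hdense 0
  have := image_closure_subset_closure_image he ⟨0, h0, rfl⟩
  have he0 : e 0 = L := by simp [e]
  rw [he0] at this
  refine closure_mono ?_ this
  rintro _ ⟨t, ht, rfl⟩
  exact hall t ht

/-! ### Pencils of bounded rank are compression spaces -/

lemma injective_pert {E F : Type*} [NormedAddCommGroup E] [NormedSpace ℂ E]
    [NormedAddCommGroup F] [NormedSpace ℂ F] [FiniteDimensional ℂ E]
    (φ ψ : E →ₗ[ℂ] F) (h : Function.Injective φ) :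
    ∀ᶠ t : ℂ in nhds (0 : ℂ), Function.Injective ⇑(φ - t • ψ) := by
  let φc : E →L[ℂ] F := LinearMap.toContinuousLinearMap φ
  let ψc : E →L[ℂ] F := LinearMap.toContinuousLinearMap ψ
  have hcont : Continuous (fun t : ℂ => φc - t • ψc) := by fun_prop
  have hopen := (ContinuousLinearMap.isOpen_injective (𝕜 := ℂ) (E := E) (F := F))
  have e0 : φc - (0 : ℂ) • ψc = φc := by ext; simp
  have hm : {L : E →L[ℂ] F | Function.Injective L} ∈ nhds (φc - (0 : ℂ) • ψc) :=
    hopen.mem_nhds (by rw [e0]; exact h)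
  exact hcont.continuousAt.eventually hm

lemma compression_core {p q : ℕ} (F G : (Fin q → ℂ) →ₗ[ℂ] (Fin p → ℂ))
    (hmax : ∀ t : ℂ, Module.finrank ℂ (LinearMap.range (F - t • G)) ≤
      Module.finrank ℂ (LinearMap.range F)) :
    ∃ W : Submodule ℂ (Fin q → ℂ), LinearMap.ker F ≤ W ∧ W.map G ≤ W.map F := by
  let Φ : Submodule ℂ (Fin q → ℂ) →o Submodule ℂ (Fin q → ℂ) :=
    ⟨fun W => (W.map G).comap F, fun W W' h => Submodule.comap_mono (Submodule.map_mono h)⟩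
  let W := OrderHom.lfp Φ
  have hfix : (W.map G).comap F = W := OrderHom.map_lfp Φ
  have hS : ∀ w ∈ W, ∀ t : ℂ, t ≠ 0 → G w ∈ LinearMap.range (F - t • G) := by
    intro w hw t ht
    have hle : W ≤ (LinearMap.range (F - t • G)).comap G := by
      apply OrderHom.lfp_le
      intro w' hw'
      change F w' ∈ Submodule.map G _ at hw'
      obtain ⟨u, hu, huw⟩ := hw'
      change G w' ∈ LinearMap.range (F - t • G)
      have hu' : G u ∈ LinearMap.range (F - t • G) := hu
      have h2 : (F - t • G) w' ∈ LinearMap.range (F - t • G) := ⟨w', rfl⟩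
      have h3 := (LinearMap.range (F - t • G)).smul_mem t⁻¹
        ((LinearMap.range (F - t • G)).sub_mem hu' h2)
      convert h3 using 1
      rw [huw, LinearMap.sub_apply, LinearMap.smul_apply, sub_sub_cancel, smul_smul,
        inv_mul_cancel₀ ht, one_smul]
    exact hle hw
  have hrange : W.map G ≤ LinearMap.range F := by
    rintro _ ⟨w, hw, rfl⟩
    by_contra hcon
    obtain ⟨K, hK⟩ := Submodule.exists_isCompl (LinearMap.ker F)
    let φ : (K × ℂ) →ₗ[ℂ] (Fin p → ℂ) :=
      (F ∘ₗ K.subtype).coprod (LinearMap.toSpanSingleton ℂ _ (G w))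
    let ψ : (K × ℂ) →ₗ[ℂ] (Fin p → ℂ) := (G ∘ₗ K.subtype).coprod 0
    have hφ : Function.Injective φ := by
      rw [← LinearMap.ker_eq_bot, LinearMap.ker_eq_bot']
      rintro ⟨k, c⟩ h
      have h' : F k + c • G w = 0 := h
      have hc : c = 0 := by
        by_contra hc
        apply hcon
        refine ⟨-(c⁻¹ • (k : Fin q → ℂ)), ?_⟩
        have : F k = - (c • G w) := eq_neg_of_add_eq_zero_left h'
        rw [map_neg, map_smul, this, smul_neg, neg_neg, smul_smul, inv_mul_cancel₀ hc, one_smul]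
      subst hc
      rw [zero_smul, add_zero] at h'
      have hk : (k : Fin q → ℂ) ∈ LinearMap.ker F ⊓ K := ⟨h', k.2⟩
      rw [hK.inf_eq_bot, Submodule.mem_bot] at hk
      exact Prod.ext (Subtype.ext hk) rfl
    have hev := injective_pert φ ψ hφ
    have hev' : ∀ᶠ t : ℂ in nhdsWithin (0 : ℂ) {0}ᶜ, Function.Injective ⇑(φ - t • ψ) ∧ t ≠ 0 :=
      (hev.filter_mono nhdsWithin_le_nhds).and self_mem_nhdsWithin
    obtain ⟨t, hinj, ht⟩ := hev'.exists
    have hinj' : Function.Injective (φ - t • ψ) := hinj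
    have hle : LinearMap.range (φ - t • ψ) ≤ LinearMap.range (F - t • G) := by
      rintro _ ⟨⟨k, c⟩, rfl⟩
      have : (φ - t • ψ) (k, c) = (F - t • G) k + c • G w := by
        simp only [φ, ψ, LinearMap.sub_apply, LinearMap.smul_apply, LinearMap.coprod_apply,
          LinearMap.comp_apply, Submodule.subtype_apply, LinearMap.toSpanSingleton_apply,
          LinearMap.zero_apply, add_zero]
        abel
      rw [this]
      exact Submodule.add_mem _ ⟨_, rfl⟩ (Submodule.smul_mem _ _ (hS w hw t ht))
    have h1 := Submodule.finrank_mono hle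
    rw [LinearMap.finrank_range_of_inj hinj', Module.finrank_prod, Module.finrank_self] at h1
    have h2 := hmax t
    have h3 := LinearMap.finrank_range_add_finrank_ker F
    have h4 := Submodule.finrank_add_eq_of_isCompl hK
    omega
  refine ⟨W, ?_, ?_⟩
  · intro w hw
    rw [← hfix]
    rw [Submodule.mem_comap]
    rw [LinearMap.mem_ker.1 hw]
    exact Submodule.zero_mem _
  · intro u hu
    obtain ⟨w, rfl⟩ := hrange hu
    have : w ∈ (W.map G).comap F := hu
    rw [hfix] at this
    exact ⟨w, this, rfl⟩

lemma exists_sub_finrank {V : Type*} [AddCommGroup V] [Module ℂ V] [FiniteDimensional ℂ V]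
    (W : Submodule ℂ V) (k : ℕ) (hk : k ≤ Module.finrank ℂ W) :
    ∃ W' ≤ W, Module.finrank ℂ W' = k := by
  let bs := Module.finBasis ℂ W
  let f : Fin k → V := fun i => (bs (Fin.castLE hk i) : V)
  have hf : LinearIndependent ℂ f := by
    have h1 := bs.linearIndependent.comp (Fin.castLE hk) (Fin.castLE_injective hk)
    exact h1.map' W.subtype (Submodule.ker_subtype W)
  refine ⟨Submodule.span ℂ (Set.range f), ?_, ?_⟩
  · rw [Submodule.span_le]
    rintro _ ⟨i, rfl⟩
    exact (bs (Fin.castLE hk i)).2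
  · rw [finrank_span_eq_card hf, Fintype.card_fin]

lemma compression {p q ρ : ℕ} (A B : Matrix (Fin p) (Fin q) ℂ) (hρ : ρ ≤ q)
    (h : ∀ t : ℂ, (t • A + B).rank ≤ ρ) :
    ∃ b ≤ ρ, ∃ (W : Submodule ℂ (Fin q → ℂ)) (U : Submodule ℂ (Fin p → ℂ)),
      Module.finrank ℂ W = b + (q - ρ) ∧ Module.finrank ℂ U = b ∧
      ∀ w ∈ W, A *ᵥ w ∈ U ∧ B *ᵥ w ∈ U := by
  let rk : ℂ → ℕ := fun t => (t • A + B).rank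
  let t₀ := Function.argmin (fun t => ρ - rk t)
  have ht₀ : ∀ t, rk t ≤ rk t₀ := by
    intro t
    have h1 : ρ - rk t₀ ≤ ρ - rk t := Function.argmin_le (fun t => ρ - rk t) t
    have h2 : rk t ≤ ρ := h t
    have h3 : rk t₀ ≤ ρ := h t₀
    omega
  let F := (t₀ • A + B).mulVecLin
  let G := A.mulVecLin
  have hFG : ∀ t : ℂ, F - t • G = ((t₀ - t) • A + B).mulVecLin := by
    intro t
    refine LinearMap.ext fun v => ?_
    simp only [F, G, LinearMap.sub_apply, LinearMap.smul_apply, Matrix.mulVecLin_apply,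
      Matrix.add_mulVec, sub_smul, Matrix.sub_mulVec, Matrix.smul_mulVec]
    abel
  obtain ⟨W, hker, hWG⟩ := compression_core F G (by
    intro t
    rw [hFG]
    exact ht₀ (t₀ - t))
  have hr : Module.finrank ℂ (LinearMap.range F) ≤ ρ := h t₀
  have hU : W.map F ≤ LinearMap.range F := LinearMap.map_le_range
  have hU' := Submodule.finrank_mono hU
  have h1 := LinearMap.finrank_range_add_finrank_ker F
  have h2 := LinearMap.finrank_range_add_finrank_ker (F.domRestrict W)
  have h3 : LinearMap.range (F.domRestrict W) = W.map F := by
    rw [LinearMap.range_domRestrict]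
  have h4 : Module.finrank ℂ (LinearMap.ker (F.domRestrict W)) =
      Module.finrank ℂ (LinearMap.ker F) := by
    rw [LinearMap.ker_domRestrict]
    exact (Submodule.comapSubtypeEquivOfLe hker).finrank_eq
  rw [h3, h4] at h2
  rw [Module.finrank_fin_fun] at h1
  obtain ⟨W', hW'W, hW'⟩ := exists_sub_finrank W (Module.finrank ℂ (W.map F) + (q - ρ)) (by omega)
  refine ⟨Module.finrank ℂ (W.map F), by omega, W', W.map F, hW', rfl, ?_⟩
  intro w hw
  have hA : A *ᵥ w ∈ W.map F := hWG ⟨w, hW'W hw, rfl⟩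
  have hF : (t₀ • A + B) *ᵥ w ∈ W.map F := ⟨w, hW'W hw, rfl⟩
  refine ⟨hA, ?_⟩
  have := (W.map F).sub_mem hF ((W.map F).smul_mem t₀ hA)
  rwa [Matrix.add_mulVec, Matrix.smul_mulVec, add_sub_cancel_left] at this

lemma adapted_basis {q c : ℕ} (W : Submodule ℂ (Fin q → ℂ)) (hW : Module.finrank ℂ W = c) :
    ∃ bs : Module.Basis (Fin q) ℂ (Fin q → ℂ), (∀ y : Fin q, (y : ℕ) < c → bs y ∈ W) ∧
      ∀ w ∈ W, ∀ y : Fin q, c ≤ (y : ℕ) → bs.repr w y = 0 := by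
  obtain ⟨C, hC⟩ := Submodule.exists_isCompl W
  have h4 := Submodule.finrank_add_eq_of_isCompl hC
  rw [Module.finrank_fin_fun, hW] at h4
  let b1 := Module.finBasisOfFinrankEq ℂ W hW
  let b2 := Module.finBasis ℂ C
  let e : Fin c ⊕ Fin (Module.finrank ℂ C) ≃ Fin q := finSumFinEquiv.trans (finCongr h4)
  let bs := ((b1.prod b2).map (Submodule.prodEquivOfIsCompl W C hC)).reindex e
  have e1 : ∀ i, bs (e (Sum.inl i)) = b1 i := by
    intro i; simp [bs]
  have ev : ∀ i, (e (Sum.inl i) : ℕ) = i := by intro i; simp [e]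
  refine ⟨bs, ?_, ?_⟩
  · intro y hy
    have : y = e (Sum.inl ⟨y, hy⟩) := Fin.ext (ev ⟨y, hy⟩).symm
    rw [this, e1]
    exact (b1 _).2
  · intro w hw y hy
    have hw' : w = ∑ i, b1.repr ⟨w, hw⟩ i • bs (e (Sum.inl i)) := by
      have := congrArg W.subtype (b1.sum_repr ⟨w, hw⟩)
      rw [map_sum] at this
      simp only [map_smul, Submodule.subtype_apply] at this
      simp only [e1]
      exact this.symm
    rw [hw', map_sum, Finsupp.finsetSum_apply]
    refine Finset.sum_eq_zero fun i _ => ?_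
    rw [map_smul, Module.Basis.repr_self, Finsupp.smul_apply, Finsupp.single_apply, if_neg, smul_zero]
    intro h
    have := ev i
    rw [h] at this
    have := i.2
    omega

lemma exists_inE {p q ρ : ℕ} (L : Pencil p q) (hρ : ρ ≤ q)
    (h : ∀ t : ℂ, (t • L.1 + L.2).rank ≤ ρ) :
    ∃ b ≤ ρ, ∃ L' : Pencil p q, StrictEquiv L' L ∧ InE b (b + (q - ρ)) L' := by
  obtain ⟨b, hb, W, U, hW, hU, hWU⟩ := compression L.1 L.2 hρ h
  obtain ⟨bW, hbW, -⟩ := adapted_basis W hW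
  obtain ⟨bU, -, hbU⟩ := adapted_basis U hU
  let P := bU.toMatrix (Pi.basisFun ℂ (Fin p))
  let Q := (Pi.basisFun ℂ (Fin q)).toMatrix bW
  have hP : IsUnit P := by
    have := bU.invertibleToMatrix (Pi.basisFun ℂ (Fin p))
    exact isUnit_of_invertible _
  have hQ : IsUnit Q := by
    have := (Pi.basisFun ℂ (Fin q)).invertibleToMatrix bW
    exact isUnit_of_invertible _
  have key : ∀ (A : Matrix (Fin p) (Fin q) ℂ) x y, (P * A * Q) x y = bU.repr (A *ᵥ bW y) x := by
    intro A x y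
    have h1 := basis_toMatrix_mul_linearMap_toMatrix_mul_basis_toMatrix
      (b := bW) (b' := Pi.basisFun ℂ (Fin q)) (c := bU) (c' := Pi.basisFun ℂ (Fin p))
      (Matrix.toLin' A)
    have h2 : LinearMap.toMatrix (Pi.basisFun ℂ (Fin q)) (Pi.basisFun ℂ (Fin p)) (Matrix.toLin' A) = A := by
      exact LinearMap.toMatrix'_toLin' A
    rw [h2] at h1
    rw [h1, LinearMap.toMatrix_apply, Matrix.toLin'_apply]
  refine ⟨b, hb, (P * L.1 * Q, P * L.2 * Q), StrictEquiv.of_eq P Q hP hQ rfl rfl, ?_⟩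
  intro x y hx hy
  have := hWU _ (hbW y hy)
  exact ⟨(key _ _ _).trans (hbU _ this.1 x hx), (key _ _ _).trans (hbU _ this.2 x hx)⟩

/-! ### The pairwise block computations -/

lemma pair_RR (k' k : ℕ) (hk : k' ≤ k + 1) (d1 d0 : ℕ → ℕ → ℂ)
    (hX : ∀ i < k', ∀ j < k, d1 i j + d0 i (j+1) = 0)
    (hY0 : ∀ j ≤ k, 0 < k' → d1 0 j = 0)
    (hY : ∀ j ≤ k, ∀ i, i + 1 < k' → d1 (i+1) j + d0 i j = 0)
    (hY1 : ∀ j ≤ k, ∀ i, i + 1 = k' → d0 i j = 0) :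
    ∀ i < k', ∀ j ≤ k, d1 i j = 0 ∧ d0 i j = 0 := by
  have back : ∀ i, i < k' → ∀ j, j ≤ k → i < j → d0 i j = 0 := by
    intro i
    induction i with
    | zero =>
      intro hi j hj hij
      obtain ⟨j, rfl⟩ : ∃ j', j = j' + 1 := ⟨j - 1, by omega⟩
      have := hX 0 hi j (by omega)
      rwa [hY0 j (by omega) hi, zero_add] at this
    | succ i ih =>
      intro hi j hj hij
      obtain ⟨j, rfl⟩ : ∃ j', j = j' + 1 := ⟨j - 1, by omega⟩
      have h1 := hX (i+1) hi j (by omega)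
      have h2 := hY j (by omega) i hi
      rw [ih (by omega) j (by omega) (by omega), add_zero] at h2
      rwa [h2, zero_add] at h1
  have forw : ∀ s i, i + 1 + s = k' → ∀ j, j ≤ i → d0 i j = 0 := by
    intro s
    induction s with
    | zero => intro i hi j hij; exact hY1 j (by omega) i (by omega)
    | succ s ih =>
      intro i hi j hij
      have h1 := hX (i+1) (by omega) j (by omega)
      have h2 := hY j (by omega) i (by omega)
      rw [ih (i+1) (by omega) (j+1) (by omega), add_zero] at h1
      rwa [h1, zero_add] at h2
  have all0 : ∀ i < k', ∀ j ≤ k, d0 i j = 0 := by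
    intro i hi j hj
    by_cases h : i < j
    · exact back i hi j hj h
    · exact forw (k' - 1 - i) i (by omega) j (by omega)
  intro i hi j hj
  refine ⟨?_, all0 i hi j hj⟩
  rcases i with _ | i
  · exact hY0 j hj hi
  · have := hY j hj i hi
    rwa [all0 i (by omega) j hj, add_zero] at this

lemma pair_RL (k' f : ℕ) (d1 d0 : ℕ → ℕ → ℂ)
    (hX0 : ∀ i < k', 0 < f → d1 i 0 = 0)
    (hX : ∀ i < k', ∀ j, j + 1 < f → d1 i (j+1) + d0 i j = 0)
    (hY : ∀ j < f, ∀ i, i + 1 < k' → d1 (i+1) j + d0 i j = 0)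
    (hY1 : ∀ j < f, ∀ i, i + 1 = k' → d0 i j = 0) :
    ∀ i < k', ∀ j < f, d1 i j = 0 ∧ d0 i j = 0 := by
  have all1 : ∀ j, j < f → ∀ i < k', d1 i j = 0 := by
    intro j
    induction j with
    | zero => intro hj i hi; exact hX0 i hi hj
    | succ j ih =>
      intro hj i hi
      have h0 : d0 i j = 0 := by
        by_cases h : i + 1 < k'
        · have := hY j (by omega) i h
          rwa [ih (by omega) _ h, zero_add] at this
        · exact hY1 j (by omega) i (by omega)
      have := hX i hi j hj
      rwa [h0, add_zero] at this
  intro i hi j hj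
  refine ⟨all1 j hj i hi, ?_⟩
  by_cases h : i + 1 < k'
  · have := hY j hj i h
    rwa [all1 j hj _ h, zero_add] at this
  · exact hY1 j hj i (by omega)

/-! ### Block coordinates -/

lemma off_succ (sz : ℕ → ℕ) (b : ℕ) : off sz (b+1) = off sz b + sz b := by
  simp [off, Finset.sum_range_succ]

lemma off_mono (sz : ℕ → ℕ) {a b : ℕ} (h : a ≤ b) : off sz a ≤ off sz b :=
  Finset.sum_le_sum_of_subset (Finset.range_mono h)

lemma off_lt (sz : ℕ → ℕ) {a b : ℕ} (h : a < b) : off sz a + sz a ≤ off sz b := by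
  rw [← off_succ]; exact off_mono sz h

lemma exists_block (sz : ℕ → ℕ) (N x : ℕ) (hx : x < off sz N) :
    ∃ b < N, ∃ i < sz b, x = off sz b + i := by
  induction N with
  | zero => simp [off] at hx
  | succ N ih =>
    by_cases h : x < off sz N
    · obtain ⟨b, hb, i, hi, e⟩ := ih h
      exact ⟨b, by omega, i, hi, e⟩
    · rw [off_succ] at hx
      exact ⟨N, by omega, x - off sz N, by omega, by omega⟩

lemma block_iff (sz : ℕ → ℕ) (b b' i : ℕ) (hi : i < sz b) :
    (off sz b' ≤ off sz b + i ∧ off sz b + i < off sz b' + sz b') ↔ b' = b := by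
  constructor
  · rintro ⟨h1, h2⟩
    rcases lt_trichotomy b' b with h | h | h
    · have := off_lt sz h; omega
    · exact h
    · have := off_lt sz h; omega
  · rintro rfl; omega

/-- natural number version of the entries of `dsum` -/
noncomputable def dsN (N : ℕ) (ρ γ : ℕ → ℕ) (ent : ℕ → ℕ → ℕ → ℂ) (x y : ℕ) : ℂ :=
  ∑ b ∈ Finset.range N,
    if off ρ b ≤ x ∧ x < off ρ b + ρ b ∧ off γ b ≤ y ∧ y < off γ b + γ b
    then ent b (x - off ρ b) (y - off γ b) else 0

lemma dsN_row {N : ℕ} {ρ γ : ℕ → ℕ} {ent : ℕ → ℕ → ℕ → ℂ} {b i : ℕ} (hb : b < N)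
    (hi : i < ρ b) (y : ℕ) : dsN N ρ γ ent (off ρ b + i) y =
      if off γ b ≤ y ∧ y < off γ b + γ b then ent b i (y - off γ b) else 0 := by
  unfold dsN
  rw [Finset.sum_eq_single b]
  · have : off ρ b ≤ off ρ b + i ∧ off ρ b + i < off ρ b + ρ b := by omega
    simp only [this, true_and, Nat.add_sub_cancel_left]
  · intro b' _ hne
    rw [if_neg]
    rintro ⟨h1, h2, -⟩
    exact hne ((block_iff ρ b b' i hi).1 ⟨h1, h2⟩)
  · intro h; exact absurd (Finset.mem_range.2 hb) h

lemma dsN_col {N : ℕ} {ρ γ : ℕ → ℕ} {ent : ℕ → ℕ → ℕ → ℂ} {b j : ℕ} (hb : b < N)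
    (hj : j < γ b) (x : ℕ) : dsN N ρ γ ent x (off γ b + j) =
      if off ρ b ≤ x ∧ x < off ρ b + ρ b then ent b (x - off ρ b) j else 0 := by
  unfold dsN
  rw [Finset.sum_eq_single b]
  · have : off γ b ≤ off γ b + j ∧ off γ b + j < off γ b + γ b := by omega
    simp only [this, and_true, Nat.add_sub_cancel_left]
  · intro b' _ hne
    rw [if_neg]
    rintro ⟨-, -, h1, h2⟩
    exact hne ((block_iff γ b b' j hj).1 ⟨h1, h2⟩)
  · intro h; exact absurd (Finset.mem_range.2 hb) h

lemma dsN_row_sum {N : ℕ} {ρ γ : ℕ → ℕ} {ent : ℕ → ℕ → ℕ → ℂ} {b i q h : ℕ} (hb : b < N)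
    (hi : i < ρ b) (hq : off γ N = q) (g : ℕ → ℂ)
    (hent : ∀ j < γ b, ent b i j = if j = h then 1 else 0) :
    ∑ y ∈ Finset.range q, g y * dsN N ρ γ ent (off ρ b + i) y =
      if h < γ b then g (off γ b + h) else 0 := by
  have hle := off_lt γ hb
  split_ifs with hh
  · rw [Finset.sum_eq_single (off γ b + h)]
    · rw [dsN_row hb hi, if_pos (by omega), Nat.add_sub_cancel_left, hent h hh, if_pos rfl, mul_one]
    · intro y _ hy
      rw [dsN_row hb hi]
      split_ifs with h1
      · rw [hent _ (by omega), if_neg (by omega), mul_zero]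
      · rw [mul_zero]
    · intro h1; exact absurd (Finset.mem_range.2 (by omega)) h1
  · refine Finset.sum_eq_zero fun y _ => ?_
    rw [dsN_row hb hi]
    split_ifs with h1
    · rw [hent _ (by omega), if_neg (by omega), mul_zero]
    · rw [mul_zero]

lemma dsN_col_sum {N : ℕ} {ρ γ : ℕ → ℕ} {ent : ℕ → ℕ → ℕ → ℂ} {b j p h : ℕ} (hb : b < N)
    (hj : j < γ b) (hp : off ρ N = p) (g : ℕ → ℂ)
    (hent : ∀ i < ρ b, ent b i j = if i = h then 1 else 0) :
    ∑ x ∈ Finset.range p, g x * dsN N ρ γ ent x (off γ b + j) =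
      if h < ρ b then g (off ρ b + h) else 0 := by
  have hle := off_lt ρ hb
  split_ifs with hh
  · rw [Finset.sum_eq_single (off ρ b + h)]
    · rw [dsN_col hb hj, if_pos (by omega), Nat.add_sub_cancel_left, hent h hh, if_pos rfl, mul_one]
    · intro y _ hy
      rw [dsN_col hb hj]
      split_ifs with h1
      · rw [hent _ (by omega), if_neg (by omega), mul_zero]
      · rw [mul_zero]
    · intro h1; exact absurd (Finset.mem_range.2 (by omega)) h1
  · refine Finset.sum_eq_zero fun y _ => ?_
    rw [dsN_col hb hj]
    split_ifs with h1
    · rw [hent _ (by omega), if_neg (by omega), mul_zero]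
    · rw [mul_zero]

/-! ### Dual equations in natural-number coordinates -/

/-- extension by zero -/
noncomputable def ext0 {p q : ℕ} (D : Fin p → Fin q → ℂ) (x y : ℕ) : ℂ :=
  if h : x < p ∧ y < q then D ⟨x, h.1⟩ ⟨y, h.2⟩ else 0

lemma ext0_apply {p q : ℕ} (D : Fin p → Fin q → ℂ) (x : Fin p) (y : Fin q) :
    ext0 D x y = D x y := by
  unfold ext0; rw [dif_pos ⟨x.2, y.2⟩]

lemma test_X {p q : ℕ} (L : Pencil p q) (D1 D0 : Fin p → Fin q → ℂ) (u w : Fin p)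
    (h : ∑ x, ∑ y, (D1 x y * (Matrix.single u w (1 : ℂ) * L.1 : Matrix (Fin p) (Fin q) ℂ) x y
      + D0 x y * (Matrix.single u w (1 : ℂ) * L.2 : Matrix (Fin p) (Fin q) ℂ) x y) = 0) :
    ∑ y, D1 u y * L.1 w y + ∑ y, D0 u y * L.2 w y = 0 := by
  rw [← h, Finset.sum_eq_single u]
  · rw [← Finset.sum_add_distrib]
    refine Finset.sum_congr rfl fun y _ => ?_
    simp
  · intro x _ hx
    refine Finset.sum_eq_zero fun y _ => ?_
    simp [Matrix.single_mul_apply_of_ne _ _ _ _ _ hx]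
  · intro h; exact absurd (Finset.mem_univ _) h

lemma test_Y {p q : ℕ} (L : Pencil p q) (D1 D0 : Fin p → Fin q → ℂ) (w v : Fin q)
    (h : ∑ x, ∑ y, (D1 x y * (L.1 * Matrix.single w v (1 : ℂ) : Matrix (Fin p) (Fin q) ℂ) x y
      + D0 x y * (L.2 * Matrix.single w v (1 : ℂ) : Matrix (Fin p) (Fin q) ℂ) x y) = 0) :
    ∑ x, D1 x v * L.1 x w + ∑ x, D0 x v * L.2 x w = 0 := by
  rw [← h, ← Finset.sum_add_distrib]
  refine Finset.sum_congr rfl fun x _ => ?_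
  rw [Finset.sum_eq_single v]
  · simp
  · intro y _ hy
    simp [Matrix.mul_single_apply_of_ne _ _ _ _ _ hy]
  · intro h; exact absurd (Finset.mem_univ _) h

lemma sec_right {c₁ c₂ c₃ e f b : ℕ} (hb : b < c₁ + c₂) :
    ∃ k, e ≤ k ∧ k ≤ e + 1 ∧ secSize c₁ c₂ c₃ (e+1) e (f+1+1) (f+1) b = k ∧
      secSize c₁ c₂ c₃ (e+1+1) (e+1) (f+1) f b = k + 1 := by
  by_cases h : b < c₁
  · exact ⟨e+1, by omega, by omega, by simp [secSize, h], by simp [secSize, h]⟩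
  · exact ⟨e, by omega, by omega, by simp [secSize, h, hb], by simp [secSize, h, hb]⟩

lemma sec_left {c₁ c₂ c₃ e f b : ℕ} (hb : ¬ b < c₁ + c₂) :
    ∃ k, f ≤ k ∧ k ≤ f + 1 ∧ secSize c₁ c₂ c₃ (e+1) e (f+1+1) (f+1) b = k + 1 ∧
      secSize c₁ c₂ c₃ (e+1+1) (e+1) (f+1) f b = k := by
  have h1 : ¬ b < c₁ := by omega
  by_cases h : b < c₁ + c₂ + c₃
  · exact ⟨f+1, by omega, by omega, by simp [secSize, h, h1, hb], by simp [secSize, h, h1, hb]⟩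
  · exact ⟨f, by omega, by omega, by simp [secSize, h, h1, hb], by simp [secSize, h, h1, hb]⟩

lemma tanE_X {p q b c : ℕ} (K : Pencil p q) (D1 D0 : Fin p → Fin q → ℂ)
    (hT : ∀ v, ∑ x, ∑ y, (D1 x y * (tanE b c K v).1 x y + D0 x y * (tanE b c K v).2 x y) = 0)
    (u w : Fin p) (h : ¬ (b ≤ (u : ℕ) ∧ (w : ℕ) < b)) :
    ∑ y, D1 u y * K.1 w y + ∑ y, D0 u y * K.2 w y = 0 := by
  apply test_X
  have h1 := hT ((Matrix.single u w 1, 0), 0)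
  have e1 : parX p q b ((Matrix.single u w 1, 0), 0) = Matrix.single u w 1 := by
    ext i j
    simp only [parX, LinearMap.comp_apply, LinearMap.fst_apply, keep_apply]
    by_cases hij : u = i ∧ w = j
    · obtain ⟨rfl, rfl⟩ := hij
      rw [if_pos h]
    · rw [Matrix.single_apply, if_neg hij, ite_self]
  have e2 : parY p q c ((Matrix.single u w 1, 0), 0) = 0 := by simp [parY]
  have e3 : parZ p q b c ((Matrix.single u w 1, 0), 0) = 0 := by simp [parZ]
  simp only [tanE, tanL, LinearMap.add_apply, LinearMap.coe_mk, AddHom.coe_mk, e1, e2, e3,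
    Matrix.mul_zero, add_zero] at h1
  exact h1

lemma tanE_Y {p q b c : ℕ} (K : Pencil p q) (D1 D0 : Fin p → Fin q → ℂ)
    (hT : ∀ v, ∑ x, ∑ y, (D1 x y * (tanE b c K v).1 x y + D0 x y * (tanE b c K v).2 x y) = 0)
    (w v : Fin q) (h : ¬ (c ≤ (w : ℕ) ∧ (v : ℕ) < c)) :
    ∑ x, D1 x v * K.1 x w + ∑ x, D0 x v * K.2 x w = 0 := by
  apply test_Y
  have h1 := hT ((0, Matrix.single w v 1), 0)
  have e1 : parY p q c ((0, Matrix.single w v 1), 0) = Matrix.single w v 1 := by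
    ext i j
    simp only [parY, LinearMap.comp_apply, LinearMap.fst_apply, LinearMap.snd_apply, keep_apply]
    by_cases hij : w = i ∧ v = j
    · obtain ⟨rfl, rfl⟩ := hij
      rw [if_pos h]
    · rw [Matrix.single_apply, if_neg hij, ite_self]
  have e2 : parX p q b ((0, Matrix.single w v 1), 0) = 0 := by simp [parX]
  have e3 : parZ p q b c ((0, Matrix.single w v 1), 0) = 0 := by simp [parZ]
  simp only [tanE, tanL, LinearMap.add_apply, LinearMap.coe_mk, AddHom.coe_mk, e1, e2, e3,
    Matrix.zero_mul, zero_add, add_zero] at h1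
  exact h1

lemma sum_single_pair {p q : ℕ} (D : Fin p → Fin q → ℂ) (u : Fin p) (v : Fin q) :
    ∑ x, ∑ y, D x y * (Matrix.single u v (1 : ℂ)) x y = D u v := by
  rw [Finset.sum_eq_single u]
  · rw [Finset.sum_eq_single v]
    · simp
    · intro y _ hy
      rw [Matrix.single_apply, if_neg (fun h => hy h.2.symm), mul_zero]
    · intro h; exact absurd (Finset.mem_univ _) h
  · intro x _ hx
    refine Finset.sum_eq_zero fun y _ => ?_
    rw [Matrix.single_apply, if_neg (fun h => hx h.1.symm), mul_zero]
  · intro h; exact absurd (Finset.mem_univ _) h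

lemma tanE_Z {p q b c : ℕ} (K : Pencil p q) (D1 D0 : Fin p → Fin q → ℂ)
    (hT : ∀ v, ∑ x, ∑ y, (D1 x y * (tanE b c K v).1 x y + D0 x y * (tanE b c K v).2 x y) = 0)
    (u : Fin p) (v : Fin q) (h : b ≤ (u : ℕ) ∧ (v : ℕ) < c) :
    D1 u v = 0 ∧ D0 u v = 0 := by
  have ek : keep (fun (i : Fin p) (j : Fin q) => (b ≤ (i : ℕ) ∧ (j : ℕ) < c)) (Matrix.single u v 1)
      = Matrix.single u v 1 := by
    ext i j
    rw [keep_apply]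
    by_cases hij : u = i ∧ v = j
    · obtain ⟨rfl, rfl⟩ := hij
      rw [if_pos h]
    · rw [Matrix.single_apply, if_neg hij, ite_self]
  constructor
  · have h1 := hT (0, (Matrix.single u v 1, 0))
    have e1 : parY p q c (0, (Matrix.single u v 1, 0)) = 0 := by simp [parY]
    have e2 : parX p q b (0, (Matrix.single u v 1, 0)) = 0 := by simp [parX]
    have e3 : parZ p q b c (0, (Matrix.single u v 1, 0)) = (Matrix.single u v 1, 0) := by
      simp [parZ, ek]
    simp only [tanE, tanL, LinearMap.add_apply, LinearMap.coe_mk, AddHom.coe_mk, e1, e2, e3,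
      Matrix.zero_mul, Matrix.mul_zero, zero_add, add_zero, Prod.mk_add_mk, Matrix.zero_apply,
      mul_zero, sum_single_pair] at h1
    exact h1
  · have h1 := hT (0, (0, Matrix.single u v 1))
    have e1 : parY p q c (0, (0, Matrix.single u v 1)) = 0 := by simp [parY]
    have e2 : parX p q b (0, (0, Matrix.single u v 1)) = 0 := by simp [parX]
    have e3 : parZ p q b c (0, (0, Matrix.single u v 1)) = (0, Matrix.single u v 1) := by
      simp [parZ, ek]
    simp only [tanE, tanL, LinearMap.add_apply, LinearMap.coe_mk, AddHom.coe_mk, e1, e2, e3,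
      Matrix.zero_mul, Matrix.mul_zero, zero_add, add_zero, Prod.mk_add_mk, Matrix.zero_apply,
      mul_zero, sum_single_pair] at h1
    exact h1

theorem gen_surj (c₁ c₂ c₃ c₄ e f p q : ℕ)
    (hp : off (secSize c₁ c₂ c₃ (e+1) e (f+1+1) (f+1)) (c₁+c₂+c₃+c₄) = p)
    (hq : off (secSize c₁ c₂ c₃ (e+1+1) (e+1) (f+1) f) (c₁+c₂+c₃+c₄) = q) :
    Function.Surjective (tanE (off (secSize c₁ c₂ c₃ (e+1) e (f+1+1) (f+1)) (c₁+c₂))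
      (off (secSize c₁ c₂ c₃ (e+1+1) (e+1) (f+1) f) (c₁+c₂))
      (genPencil c₁ c₂ c₃ c₄ (e+1) e (f+1) f p q)) := by
  apply surj_of_dual
  intro D1 D0 hT
  have hX := tanE_X _ D1 D0 hT
  have hY := tanE_Y _ D1 D0 hT
  have hZ := tanE_Z _ D1 D0 hT
  clear hT
  set R := secSize c₁ c₂ c₃ (e+1) e (f+1+1) (f+1) with hR
  set C := secSize c₁ c₂ c₃ (e+1+1) (e+1) (f+1) f with hC
  set N := c₁+c₂+c₃+c₄ with hN
  have rowin : ∀ b < N, ∀ i < R b, off R b + i < p := fun b hb i hi => by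
    have := off_lt R hb; omega
  have colin : ∀ b < N, ∀ i < C b, off C b + i < q := fun b hb i hi => by
    have := off_lt C hb; omega
  let ent1 : ℕ → ℕ → ℕ → ℂ := fun _ i j => if i = j then 1 else 0
  let ent0 : ℕ → ℕ → ℕ → ℂ := fun b i j => if b < c₁ + c₂ then (if j = i+1 then 1 else 0)
       else (if i = j+1 then 1 else 0)
  let E1 := ext0 D1
  let E0 := ext0 D0
  have rowlt : ∀ b < N, ∀ i < R b, (off R b + i < off R (c₁+c₂) ↔ b < c₁ + c₂) := by
    intro b hb i hi
    constructor
    · intro h; by_contra h'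
      have := off_mono R (show c₁ + c₂ ≤ b by omega); omega
    · intro h; have := off_lt R h; omega
  have collt : ∀ b < N, ∀ i < C b, (off C b + i < off C (c₁+c₂) ↔ b < c₁ + c₂) := by
    intro b hb i hi
    constructor
    · intro h; by_contra h'
      have := off_mono C (show c₁ + c₂ ≤ b by omega); omega
    · intro h; have := off_lt C h; omega
  -- row equations
  have eqX : ∀ b' < N, ∀ i < R b', ∀ b < N, ∀ j < R b, (b' < c₁ + c₂ ∨ ¬ b < c₁ + c₂) →
      ∀ h, (∀ y < C b, ent0 b j y = if y = h then 1 else 0) →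
      (if j < C b then E1 (off R b' + i) (off C b + j) else 0) +
      (if h < C b then E0 (off R b' + i) (off C b + h) else 0) = 0 := by
    intro b' hb' i hi b hb j hj hor h hh
    have := hX ⟨_, rowin b' hb' i hi⟩ ⟨_, rowin b hb j hj⟩ (by
      have h1 := rowlt b' hb' i hi
      have h2 := rowlt b hb j hj
      simp only
      omega)
    rw [← dsN_row_sum hb hj hq (fun y => E1 (off R b' + i) y) (ent := ent1) (ρ := R) (h := j)
      (fun y _ => by simp only [ent1, eq_comm]),
      ← dsN_row_sum hb hj hq (fun y => E0 (off R b' + i) y) (ent := ent0) (ρ := R) hh]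
    rw [← this]
    congr 1
    · rw [Finset.sum_range]
      refine Finset.sum_congr rfl fun y _ => ?_
      rw [← ext0_apply D1 ⟨_, rowin b' hb' i hi⟩ y]
      rfl
    · rw [Finset.sum_range]
      refine Finset.sum_congr rfl fun y _ => ?_
      rw [← ext0_apply D0 ⟨_, rowin b' hb' i hi⟩ y]
      rfl
  -- column equations
  have eqY : ∀ b' < N, ∀ i < C b', ∀ b < N, ∀ j < C b, (b' < c₁ + c₂ ∨ ¬ b < c₁ + c₂) →
      ∀ h, (∀ x < R b', ent0 b' x i = if x = h then 1 else 0) →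
      (if i < R b' then E1 (off R b' + i) (off C b + j) else 0) +
      (if h < R b' then E0 (off R b' + h) (off C b + j) else 0) = 0 := by
    intro b' hb' i hi b hb j hj hor h hh
    have := hY ⟨_, colin b' hb' i hi⟩ ⟨_, colin b hb j hj⟩ (by
      have h1 := collt b' hb' i hi
      have h2 := collt b hb j hj
      simp only
      omega)
    rw [← dsN_col_sum hb' hi hp (fun x => E1 x (off C b + j)) (ent := ent1) (γ := C) (h := i)
      (fun y _ => by simp only [ent1]),
      ← dsN_col_sum hb' hi hp (fun x => E0 x (off C b + j)) (ent := ent0) (γ := C) hh]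
    rw [← this]
    congr 1
    · rw [Finset.sum_range]
      refine Finset.sum_congr rfl fun x _ => ?_
      rw [← ext0_apply D1 x ⟨_, colin b hb j hj⟩]
      rfl
    · rw [Finset.sum_range]
      refine Finset.sum_congr rfl fun x _ => ?_
      rw [← ext0_apply D0 x ⟨_, colin b hb j hj⟩]
      rfl
  have main : ∀ b' < N, ∀ b < N, ∀ i < R b', ∀ j < C b,
      E1 (off R b' + i) (off C b + j) = 0 ∧ E0 (off R b' + i) (off C b + j) = 0 := by
    intro b' hb' b hb
    by_cases h1 : b' < c₁ + c₂
    · obtain ⟨k', hk1, hk2, hRb', hCb'⟩ := sec_right (c₃ := c₃) (e := e) (f := f) h1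
      rw [← hR] at hRb'
      rw [← hC] at hCb'
      have Y0 : ∀ j < C b, 0 < k' → E1 (off R b' + 0) (off C b + j) = 0 := by
        intro j hj h0
        have := eqY b' hb' 0 (by omega) b hb j hj (Or.inl h1) (R b') (fun x hx => by
          simp only [ent0, if_pos h1]; rw [if_neg (by omega), if_neg (by omega)])
        rwa [if_pos (by omega), if_neg (by omega), add_zero] at this
      have Y1 : ∀ j < C b, ∀ i, i + 1 < k' → E1 (off R b' + (i+1)) (off C b + j) +
          E0 (off R b' + i) (off C b + j) = 0 := by
        intro j hj i hi
        have := eqY b' hb' (i+1) (by omega) b hb j hj (Or.inl h1) i (fun x hx => by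
          simp only [ent0, if_pos h1, Nat.add_right_cancel_iff, eq_comm])
        rwa [if_pos (by omega), if_pos (by omega)] at this
      have Y2 : ∀ j < C b, ∀ i, i + 1 = k' → E0 (off R b' + i) (off C b + j) = 0 := by
        intro j hj i hi
        have := eqY b' hb' (i+1) (by omega) b hb j hj (Or.inl h1) i (fun x hx => by
          simp only [ent0, if_pos h1, Nat.add_right_cancel_iff, eq_comm])
        rwa [if_neg (by omega), if_pos (by omega), zero_add] at this
      by_cases h2 : b < c₁ + c₂
      · obtain ⟨k, hk3, hk4, hRb, hCb⟩ := sec_right (c₃ := c₃) (e := e) (f := f) h2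
        rw [← hR] at hRb
        rw [← hC] at hCb
        have := pair_RR k' k (by omega) (fun i j => E1 (off R b' + i) (off C b + j))
          (fun i j => E0 (off R b' + i) (off C b + j)) (by
            intro i hi j hj
            have := eqX b' hb' i (by omega) b hb j (by omega) (Or.inl h1) (j+1) (fun x hx => by
              simp only [ent0, if_pos h2])
            rwa [if_pos (by omega), if_pos (by omega)] at this)
          (fun j hj => Y0 j (by omega)) (fun j hj => Y1 j (by omega)) (fun j hj => Y2 j (by omega))
        intro i hi j hj
        exact this i (by omega) j (by omega)
      · obtain ⟨k, hk3, hk4, hRb, hCb⟩ := sec_left (c₃ := c₃) (e := e) (f := f) h2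
        rw [← hR] at hRb
        rw [← hC] at hCb
        have := pair_RL k' k (fun i j => E1 (off R b' + i) (off C b + j))
          (fun i j => E0 (off R b' + i) (off C b + j)) (by
            intro i hi h0
            have := eqX b' hb' i (by omega) b hb 0 (by omega) (Or.inl h1) (C b) (fun x hx => by
              simp only [ent0, if_neg h2]; rw [if_neg (by omega), if_neg (by omega)])
            rwa [if_pos (by omega), if_neg (by omega), add_zero] at this) (by
            intro i hi j hj
            have := eqX b' hb' i (by omega) b hb (j+1) (by omega) (Or.inl h1) j (fun x hx => by
              simp only [ent0, if_neg h2, Nat.add_right_cancel_iff, eq_comm])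
            rwa [if_pos (by omega), if_pos (by omega)] at this)
          (fun j hj => Y1 j (by omega)) (fun j hj => Y2 j (by omega))
        intro i hi j hj
        exact this i (by omega) j (by omega)
    · by_cases h2 : b < c₁ + c₂
      · intro i hi j hj
        have := hZ ⟨_, rowin b' hb' i hi⟩ ⟨_, colin b hb j hj⟩ (by
          have h3 := rowlt b' hb' i hi
          have h4 := collt b hb j hj
          simp only
          omega)
        rw [← ext0_apply D1, ← ext0_apply D0] at this
        exact this
      · obtain ⟨k', hk1, hk2, hRb', hCb'⟩ := sec_left (c₃ := c₃) (e := e) (f := f) h1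
        rw [← hR] at hRb'
        rw [← hC] at hCb'
        obtain ⟨k, hk3, hk4, hRb, hCb⟩ := sec_left (c₃ := c₃) (e := e) (f := f) h2
        rw [← hR] at hRb
        rw [← hC] at hCb
        have := pair_RR k k' (by omega) (fun j i => E1 (off R b' + i) (off C b + j))
          (fun j i => E0 (off R b' + i) (off C b + j)) (by
            intro j hj i hi
            have := eqY b' hb' i (by omega) b hb j (by omega) (Or.inr h2) (i+1) (fun x hx => by
              simp only [ent0, if_neg h1])
            rwa [if_pos (by omega), if_pos (by omega)] at this) (by
            intro i hi h0
            have := eqX b' hb' i (by omega) b hb 0 (by omega) (Or.inr h2) (C b) (fun x hx => by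
              simp only [ent0, if_neg h2]; rw [if_neg (by omega), if_neg (by omega)])
            rwa [if_pos (by omega), if_neg (by omega), add_zero] at this) (by
            intro i hi j hj
            have := eqX b' hb' i (by omega) b hb (j+1) (by omega) (Or.inr h2) j (fun x hx => by
              simp only [ent0, if_neg h2, Nat.add_right_cancel_iff, eq_comm])
            rwa [if_pos (by omega), if_pos (by omega)] at this) (by
            intro i hi j hj
            have := eqX b' hb' i (by omega) b hb (j+1) (by omega) (Or.inr h2) j (fun x hx => by
              simp only [ent0, if_neg h2, Nat.add_right_cancel_iff, eq_comm])
            rwa [if_neg (by omega), if_pos (by omega), zero_add] at this)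
        intro i hi j hj
        exact this j (by omega) i (by omega)
  have fin : ∀ x y, D1 x y = 0 ∧ D0 x y = 0 := by
    intro x y
    obtain ⟨b', hb', i, hi, ex⟩ := exists_block R N x (by rw [hp]; exact x.2)
    obtain ⟨b, hb, j, hj, ey⟩ := exists_block C N y (by rw [hq]; exact y.2)
    have := main b' hb' b hb i hi j hj
    rw [← ex, ← ey] at this
    rw [← ext0_apply D1, ← ext0_apply D0]
    exact this
  exact ⟨fun x y => (fin x y).1, fun x y => (fin x y).2⟩

theorem gen_inE (c₁ c₂ c₃ c₄ e f p q : ℕ)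
    (hp : off (secSize c₁ c₂ c₃ (e+1) e (f+1+1) (f+1)) (c₁+c₂+c₃+c₄) = p)
    (hq : off (secSize c₁ c₂ c₃ (e+1+1) (e+1) (f+1) f) (c₁+c₂+c₃+c₄) = q) :
    InE (off (secSize c₁ c₂ c₃ (e+1) e (f+1+1) (f+1)) (c₁+c₂))
      (off (secSize c₁ c₂ c₃ (e+1+1) (e+1) (f+1) f) (c₁+c₂))
      (genPencil c₁ c₂ c₃ c₄ (e+1) e (f+1) f p q) := by
  set R := secSize c₁ c₂ c₃ (e+1) e (f+1+1) (f+1) with hR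
  set C := secSize c₁ c₂ c₃ (e+1+1) (e+1) (f+1) f with hC
  set N := c₁+c₂+c₃+c₄ with hN
  intro x y hx hy
  have key : ∀ ent, dsN N R C ent x y = 0 := by
    intro ent
    obtain ⟨b', hb', i, hi, ex⟩ := exists_block R N x (by rw [hp]; exact x.2)
    rw [ex, dsN_row hb' hi, if_neg]
    rintro ⟨h1, h2⟩
    by_cases h : b' < c₁ + c₂
    · have := off_lt R h; omega
    · have := off_mono C (show c₁ + c₂ ≤ b' by omega); omega
  exact ⟨key (fun _ i j => if i = j then 1 else 0),
    key (fun b i j => if b < c₁ + c₂ then (if j = i+1 then 1 else 0)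
       else (if i = j+1 then 1 else 0))⟩

lemma off_sec (c₁ c₂ c₃ c₄ v₁ v₂ v₃ v₄ : ℕ) :
    off (secSize c₁ c₂ c₃ v₁ v₂ v₃ v₄) (c₁+c₂) = c₁ * v₁ + c₂ * v₂ ∧
    off (secSize c₁ c₂ c₃ v₁ v₂ v₃ v₄) (c₁+c₂+c₃+c₄) =
      c₁ * v₁ + c₂ * v₂ + c₃ * v₃ + c₄ * v₄ := by
  have h1 : ∑ j ∈ Finset.range c₁, secSize c₁ c₂ c₃ v₁ v₂ v₃ v₄ j = c₁ * v₁ := by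
    rw [Finset.sum_congr rfl (g := fun _ => v₁)]
    · simp
    · intro j hj; rw [Finset.mem_range] at hj; simp [secSize, hj]
  have h2 : ∑ j ∈ Finset.range c₂, secSize c₁ c₂ c₃ v₁ v₂ v₃ v₄ (c₁ + j) = c₂ * v₂ := by
    rw [Finset.sum_congr rfl (g := fun _ => v₂)]
    · simp
    · intro j hj; rw [Finset.mem_range] at hj; simp [secSize, hj]
  have h3 : ∑ j ∈ Finset.range c₃, secSize c₁ c₂ c₃ v₁ v₂ v₃ v₄ (c₁ + c₂ + j) = c₃ * v₃ := by
    rw [Finset.sum_congr rfl (g := fun _ => v₃)]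
    · simp
    · intro j hj; rw [Finset.mem_range] at hj
      unfold secSize; rw [if_neg (by omega), if_neg (by omega), if_pos (by omega)]
  have h4 : ∑ j ∈ Finset.range c₄, secSize c₁ c₂ c₃ v₁ v₂ v₃ v₄ (c₁ + c₂ + c₃ + j) = c₄ * v₄ := by
    rw [Finset.sum_congr rfl (g := fun _ => v₄)]
    · simp
    · intro j hj; rw [Finset.mem_range] at hj
      unfold secSize; rw [if_neg (by omega), if_neg (by omega), if_neg (by omega)]
  unfold off
  constructor
  · rw [Finset.sum_range_add, h1, h2]
  · rw [Finset.sum_range_add, Finset.sum_range_add, Finset.sum_range_add, h1, h2, h3, h4]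

theorem Kp_props (p q ρ b : ℕ) (hp : ρ < p) (hq : ρ < q) (hb : b ≤ ρ) :
    InE b (b + (q - ρ)) (Kp p q ρ b) ∧
      Function.Surjective (tanE b (b + (q - ρ)) (Kp p q ρ b)) := by
  obtain ⟨g, hg, rfl⟩ : ∃ g, 0 < g ∧ q = ρ + g := ⟨q - ρ, by omega, by omega⟩
  obtain ⟨k, hk, rfl⟩ : ∃ g, 0 < g ∧ p = ρ + g := ⟨p - ρ, by omega, by omega⟩
  obtain ⟨c, rfl⟩ : ∃ c, ρ = b + c := ⟨ρ - b, by omega⟩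
  have e1 : b + c + g - (b + c) = g := by omega
  have e2 : b + c + k - (b + c) = k := by omega
  have e3 : b + c - b = c := by omega
  unfold Kp
  rw [e1, e2, e3]
  obtain ⟨s, hs⟩ : ∃ s, g = b % g + s := ⟨g - b % g, by have := Nat.mod_lt b hg; omega⟩
  obtain ⟨t, ht⟩ : ∃ s, k = c % k + s := ⟨k - c % k, by have := Nat.mod_lt c hk; omega⟩
  have e4 : g - b % g = s := by omega
  have e5 : k - c % k = t := by omega
  rw [e4, e5]
  have d1 : g * (b / g) + b % g = b := Nat.div_add_mod b g
  have d2 : k * (c / k) + c % k = c := Nat.div_add_mod c k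
  generalize b % g = s' at *
  generalize b / g = α at *
  generalize c % k = t' at *
  generalize c / k = β at *
  have oR := off_sec s' s t' t (α+1) α (β+1+1) (β+1)
  have oC := off_sec s' s t' t (α+1+1) (α+1) (β+1) β
  have r1 : s' * (α + 1) + s * α = b := by rw [← d1, hs]; ring
  have r2 : s' * (α + 1 + 1) + s * (α + 1) = b + g := by rw [← d1, hs]; ring
  have r3 : s' * (α + 1) + s * α + t' * (β+1+1) + t * (β+1) = b + c + k := by
    rw [r1, ← d2, ht]; ring
  have r4 : s' * (α + 1 + 1) + s * (α + 1) + t' * (β+1) + t * β = b + c + g := by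
    rw [r2, ← d2, ht]; ring
  rw [r3, r1] at oR
  rw [r4, r2] at oC
  have h1 := gen_inE s' s t' t α β (b+c+k) (b+c+g) oR.2 oC.2
  have h2 := gen_surj s' s t' t α β (b+c+k) (b+c+g) oR.2 oC.2
  rw [oR.1, oC.1] at h1 h2
  exact ⟨h1, h2⟩

/-! ### The companion forms are transversal to the orbits -/

/-- the linear part of the companion map -/
noncomputable def compLin (m n d : ℕ) : Pol d m n →ₗ[ℂ] Pencil (m + n*(d-1)) (n*d) where
  toFun P := (Matrix.of fun i j =>
    if hi : (i : ℕ) < m then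
      if hj : (j : ℕ) < n then P (Fin.last d) ⟨i, hi⟩ ⟨j, hj⟩ else 0
    else 0, Matrix.of fun i j =>
    if hi : (i : ℕ) < m then
      if hn : 0 < n then
        P ⟨d - 1 - (j : ℕ) / n, Nat.lt_succ_of_le ((Nat.sub_le _ _).trans (Nat.sub_le d 1))⟩
          ⟨i, hi⟩ ⟨(j : ℕ) % n, Nat.mod_lt _ hn⟩
      else 0
    else 0)
  map_add' P P' := by
    apply Prod.ext
    · ext i j
      simp only [Matrix.of_apply, Prod.fst_add, Matrix.add_apply, Pi.add_apply]
      split_ifs <;> simp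
    · ext i j
      simp only [Matrix.of_apply, Prod.snd_add, Matrix.add_apply, Pi.add_apply]
      split_ifs <;> simp
  map_smul' c P := by
    apply Prod.ext
    · ext i j
      simp only [Matrix.of_apply, Prod.smul_fst, Matrix.smul_apply, Pi.smul_apply]
      split_ifs <;> simp
    · ext i j
      simp only [Matrix.of_apply, Prod.smul_snd, Matrix.smul_apply, Pi.smul_apply]
      split_ifs <;> simp

lemma comp_add (m n d : ℕ) (P P' : Pol d m n) :
    comp m n d (P + P') = comp m n d P + compLin m n d P' := by
  apply Prod.ext
  · ext i j
    simp only [comp, compA, compLin, Matrix.of_apply, Prod.fst_add, Matrix.add_apply, Pi.add_apply,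
      LinearMap.coe_mk, AddHom.coe_mk]
    split_ifs <;> simp
  · ext i j
    simp only [comp, compB, compLin, Matrix.of_apply, Prod.snd_add, Matrix.add_apply, Pi.add_apply,
      LinearMap.coe_mk, AddHom.coe_mk]
    split_ifs <;> simp

lemma compLin_surj1 {m n d : ℕ} (hd : 1 ≤ d) (x : Fin (m + n*(d-1))) (y : Fin (n*d))
    (hx : (x : ℕ) < m) (hy : (y : ℕ) < n) :
    ∃ P : Pol d m n, compLin m n d P = (Matrix.single x y 1, 0) := by
  refine ⟨Pi.single (Fin.last d) (Matrix.single ⟨x, hx⟩ ⟨y, hy⟩ 1), ?_⟩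
  apply Prod.ext
  · ext i j
    simp only [compLin, Matrix.of_apply, LinearMap.coe_mk, AddHom.coe_mk, Pi.single_eq_same,
      Matrix.single_apply, Fin.ext_iff]
    split_ifs <;> first | rfl | omega
  · ext i j
    simp only [compLin, Matrix.of_apply, LinearMap.coe_mk, AddHom.coe_mk, Matrix.zero_apply]
    split_ifs
    · rw [Pi.single_eq_of_ne]
      · rfl
      · intro h
        have := congrArg Fin.val h
        have h2 : d - 1 - (j : ℕ) / n ≤ d - 1 := Nat.sub_le _ _
        have h3 : d - 1 - (j : ℕ) / n = d := this
        omega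
    · rfl
    · rfl

lemma compLin_surj0 {m n d : ℕ} (hd : 1 ≤ d) (hn : 0 < n) (x : Fin (m + n*(d-1))) (y : Fin (n*d))
    (hx : (x : ℕ) < m) :
    ∃ P : Pol d m n, compLin m n d P = (0, Matrix.single x y 1) := by
  refine ⟨Pi.single ⟨d - 1 - (y : ℕ) / n, Nat.lt_succ_of_le ((Nat.sub_le _ _).trans (Nat.sub_le d 1))⟩
    (Matrix.single ⟨x, hx⟩ ⟨(y : ℕ) % n, Nat.mod_lt _ hn⟩ 1), ?_⟩
  have hdiv : ∀ j : Fin (n*d), (j : ℕ) / n < d := fun j =>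
    Nat.div_lt_of_lt_mul j.2
  apply Prod.ext
  · ext i j
    simp only [compLin, Matrix.of_apply, LinearMap.coe_mk, AddHom.coe_mk, Matrix.zero_apply]
    split_ifs
    · rw [Pi.single_eq_of_ne]
      · rfl
      · intro h
        have := congrArg Fin.val h
        have h2 : d - 1 - (y : ℕ) / n ≤ d - 1 := Nat.sub_le _ _
        have h3 : d = d - 1 - (y : ℕ) / n := this
        omega
    · rfl
    · rfl
  · ext i j
    simp only [compLin, Matrix.of_apply, LinearMap.coe_mk, AddHom.coe_mk]
    by_cases hi : (i : ℕ) < m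
    · rw [dif_pos hi, dif_pos hn]
      by_cases hj : (j : ℕ) / n = (y : ℕ) / n
      · have e : (⟨d - 1 - (j : ℕ) / n, Nat.lt_succ_of_le ((Nat.sub_le _ _).trans (Nat.sub_le d 1))⟩ : Fin (d+1)) =
            ⟨d - 1 - (y : ℕ) / n, Nat.lt_succ_of_le ((Nat.sub_le _ _).trans (Nat.sub_le d 1))⟩ := by
          rw [Fin.mk.injEq, hj]
        rw [e, Pi.single_eq_same]
        simp only [Matrix.single_apply, Fin.ext_iff]
        have h1 := Nat.div_add_mod (j : ℕ) n
        have h2 := Nat.div_add_mod (y : ℕ) n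
        rw [hj] at h1
        refine if_congr ?_ rfl rfl
        refine and_congr Iff.rfl ?_
        omega
      · rw [Pi.single_eq_of_ne]
        · rw [Matrix.single_apply, if_neg]
          · rfl
          · rintro ⟨-, rfl⟩; exact hj rfl
        · intro h
          have := congrArg Fin.val h
          simp only at this
          have := hdiv j
          have := hdiv y
          omega
    · rw [dif_neg hi, Matrix.single_apply, if_neg]
      rintro ⟨rfl, -⟩; exact hi hx

lemma trans_core (m n Q : ℕ) (E1 E0 : ℕ → ℕ → ℂ) (hn : 0 < n)
    (ha1 : ∀ x < m, ∀ y < n, E1 x y = 0) (ha0 : ∀ x < m, ∀ y < n + Q, E0 x y = 0)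
    (hb : ∀ u < m + Q, ∀ c < Q, E1 u (n + c) = E0 u c)
    (hc : ∀ w < n + Q, ∀ v < n + Q, (if n ≤ w then E1 (m + (w - n)) v else 0) =
      (if w < Q then E0 (m + w) v else 0)) :
    ∀ x < m + Q, ∀ y < n + Q, E1 x y = 0 ∧ E0 x y = 0 := by
  have h1 : ∀ v < n + Q, ∀ c < Q, E1 (m + c) v = if c + n < Q then E0 (m + (c + n)) v else 0 := by
    intro v hv c hcQ
    have := hc (c + n) (by omega) v hv
    rwa [if_pos (by omega), Nat.add_sub_cancel] at this
  have h2 : ∀ v < n + Q, ∀ c < Q, c < n → E0 (m + c) v = 0 := by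
    intro v hv c hcQ hcn
    have := hc c (by omega) v hv
    rw [if_neg (by omega), if_pos hcQ] at this
    exact this.symm
  have forw : ∀ s c e, c + s = Q → 0 < s → e ≤ c → E0 (m + c) e = 0 := by
    intro s
    induction s using Nat.strong_induction_on with
    | _ s ih =>
      intro c e hs h0 hec
      rw [← hb (m + c) (by omega) e (by omega), h1 _ (by omega) c (by omega)]
      split_ifs with h
      · exact ih (s - n) (by omega) (c + n) (n + e) (by omega) (by omega) (by omega)
      · rfl
  have back : ∀ c, c < Q → ∀ e, e < n + Q → c < e → E0 (m + c) e = 0 := by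
    intro c
    induction c using Nat.strong_induction_on with
    | _ c ih =>
      intro hcQ e he hce
      by_cases hcn : c < n
      · exact h2 e he c hcQ hcn
      · obtain ⟨c, rfl⟩ : ∃ c', c = c' + n := ⟨c - n, by omega⟩
        obtain ⟨e, rfl⟩ : ∃ e', e = n + e' := ⟨e - n, by omega⟩
        have := h1 (n + e) he c (by omega)
        rw [if_pos hcQ, hb (m + c) (by omega) e (by omega)] at this
        rw [← this]
        exact ih c (by omega) (by omega) e (by omega) (by omega)
  have all0 : ∀ x < m + Q, ∀ y < n + Q, E0 x y = 0 := by
    intro x hx y hy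
    by_cases hxm : x < m
    · exact ha0 x hxm y hy
    · obtain ⟨c, rfl⟩ : ∃ c, x = m + c := ⟨x - m, by omega⟩
      by_cases h : c < y
      · exact back c (by omega) y hy h
      · exact forw (Q - c) c y (by omega) (by omega) (by omega)
  intro x hx y hy
  refine ⟨?_, all0 x hx y hy⟩
  by_cases hxm : x < m
  · by_cases hyn : y < n
    · exact ha1 x hxm y hyn
    · obtain ⟨c, rfl⟩ : ∃ c, y = n + c := ⟨y - n, by omega⟩
      rw [hb x hx c (by omega), all0 x hx c (by omega)]
  · obtain ⟨c, rfl⟩ : ∃ c, x = m + c := ⟨x - m, by omega⟩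
    rw [h1 y hy c (by omega)]
    split_ifs with h
    · exact all0 _ (by omega) _ hy
    · rfl

/-- The tangent map for the companion transversality. -/
noncomputable def tanC (m n d : ℕ) (L : Pencil (m + n*(d-1)) (n*d)) :
    ((Matrix (Fin (m + n*(d-1))) (Fin (m + n*(d-1))) ℂ × Matrix (Fin (n*d)) (Fin (n*d)) ℂ)
      × Pol d m n) →ₗ[ℂ] Pencil (m + n*(d-1)) (n*d) where
  toFun v := (v.1.1 * L.1 + L.1 * v.1.2 + (compLin m n d v.2).1,
    v.1.1 * L.2 + L.2 * v.1.2 + (compLin m n d v.2).2)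
  map_add' v w := by
    apply Prod.ext <;> simp only [map_add, Matrix.add_mul, Matrix.mul_add, Prod.fst_add,
      Prod.snd_add] <;> abel
  map_smul' k v := by
    apply Prod.ext <;> simp only [map_smul, Matrix.smul_mul, Matrix.mul_smul, Prod.smul_fst,
      Prod.smul_snd, smul_add, RingHom.id_apply]

lemma tanC_surj {m n d : ℕ} (hd : 1 ≤ d) (hn : 0 < n) (P : Pol d m n) :
    Function.Surjective (tanC m n d (comp m n d P)) := by
  apply surj_of_dual
  intro D1 D0 hT
  have hX : ∀ u w, ∑ y, D1 u y * (comp m n d P).1 w y + ∑ y, D0 u y * (comp m n d P).2 w y = 0 := by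
    intro u w
    apply test_X
    have h1 := hT ((Matrix.single u w 1, 0), 0)
    simp only [tanC, LinearMap.coe_mk, AddHom.coe_mk, map_zero, Prod.fst_zero, Prod.snd_zero,
      Matrix.mul_zero, add_zero] at h1
    exact h1
  have hY : ∀ w v, ∑ x, D1 x v * (comp m n d P).1 x w + ∑ x, D0 x v * (comp m n d P).2 x w = 0 := by
    intro w v
    apply test_Y
    have h1 := hT ((0, Matrix.single w v 1), 0)
    simp only [tanC, LinearMap.coe_mk, AddHom.coe_mk, map_zero, Prod.fst_zero, Prod.snd_zero,
      Matrix.zero_mul, add_zero, zero_add] at h1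
    exact h1
  have hP1 : ∀ (x : Fin (m + n*(d-1))) (y : Fin (n*d)), (x : ℕ) < m → (y : ℕ) < n → D1 x y = 0 := by
    intro x y hx hy
    obtain ⟨P', hP'⟩ := compLin_surj1 hd x y hx hy
    have h1 := hT ((0, 0), P')
    simp only [tanC, LinearMap.coe_mk, AddHom.coe_mk, hP', Matrix.zero_apply, mul_zero,
      Matrix.zero_mul, Matrix.mul_zero, add_zero, zero_add, sum_single_pair] at h1
    exact h1
  have hP0 : ∀ (x : Fin (m + n*(d-1))) (y : Fin (n*d)), (x : ℕ) < m → D0 x y = 0 := by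
    intro x y hx
    obtain ⟨P', hP'⟩ := compLin_surj0 hd hn x y hx
    have h1 := hT ((0, 0), P')
    simp only [tanC, LinearMap.coe_mk, AddHom.coe_mk, hP', Matrix.zero_apply, mul_zero,
      Matrix.zero_mul, Matrix.mul_zero, add_zero, zero_add, sum_single_pair] at h1
    exact h1
  clear hT
  have hq : n * d = n + n * (d - 1) := by
    obtain ⟨d, rfl⟩ : ∃ d', d = d' + 1 := ⟨d - 1, by omega⟩
    rw [Nat.add_sub_cancel]; ring
  have hb : ∀ (u : Fin (m + n*(d-1))) (c : ℕ) (hc : c < n * (d-1)),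
      D1 u ⟨n + c, by omega⟩ = D0 u ⟨c, by omega⟩ := by
    intro u c hc
    have := hX u ⟨m + c, by omega⟩
    rw [Finset.sum_eq_single ⟨n + c, by omega⟩, Finset.sum_eq_single ⟨c, by omega⟩] at this
    · simp only [comp, compA, compB] at this
      rw [dif_neg (by omega), dif_neg (by omega), if_pos (by omega), if_pos (by omega)] at this
      rw [mul_one, mul_neg_one] at this
      exact eq_of_sub_eq_zero (by rw [sub_eq_add_neg]; exact this)
    · intro y _ hy
      simp only [comp, compB]
      rw [dif_neg (by omega), if_neg, mul_zero]
      intro h; apply hy; apply Fin.ext; simp only; omega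
    · intro h; exact absurd (Finset.mem_univ _) h
    · intro y _ hy
      simp only [comp, compA]
      rw [dif_neg (by omega), if_neg, mul_zero]
      intro h; apply hy; apply Fin.ext; simp only; omega
    · intro h; exact absurd (Finset.mem_univ _) h
  have hP1' : ∀ (x : Fin (m + n*(d-1))) (y : Fin (n*d)), (x : ℕ) < m → D1 x y = 0 := by
    intro x y hx
    by_cases hy : (y : ℕ) < n
    · exact hP1 x y hx hy
    · have e : y = ⟨n + ((y : ℕ) - n), by omega⟩ := by apply Fin.ext; simp only; omega
      rw [e, hb x _ (by omega), hP0 _ _ hx]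
  have hc1 : ∀ w v : Fin (n*d), ∑ x, D1 x v * (comp m n d P).1 x w =
      if n ≤ (w : ℕ) then ext0 D1 (m + (w - n)) v else 0 := by
    intro w v
    split_ifs with hw
    · rw [Finset.sum_eq_single ⟨m + (w - n), by omega⟩]
      · rw [← ext0_apply D1]
        simp only [comp, compA]
        rw [dif_neg (by omega), if_pos (by omega), mul_one]
      · intro x _ hx
        by_cases hxm : (x : ℕ) < m
        · rw [hP1' x v hxm, zero_mul]
        · simp only [comp, compA]
          rw [dif_neg hxm, if_neg, mul_zero]
          intro h; apply hx; apply Fin.ext; simp only; omega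
      · intro h; exact absurd (Finset.mem_univ _) h
    · refine Finset.sum_eq_zero fun x _ => ?_
      by_cases hxm : (x : ℕ) < m
      · rw [hP1' x v hxm, zero_mul]
      · simp only [comp, compA]
        rw [dif_neg hxm, if_neg (by omega), mul_zero]
  have hc0 : ∀ w v : Fin (n*d), ∑ x, D0 x v * (comp m n d P).2 x w =
      - if (w : ℕ) < n * (d-1) then ext0 D0 (m + w) v else 0 := by
    intro w v
    split_ifs with hw
    · rw [Finset.sum_eq_single ⟨m + w, by omega⟩]
      · rw [← ext0_apply D0]
        simp only [comp, compB]
        rw [dif_neg (by omega), if_pos (by omega), mul_neg_one]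
      · intro x _ hx
        by_cases hxm : (x : ℕ) < m
        · rw [hP0 x v hxm, zero_mul]
        · simp only [comp, compB]
          rw [dif_neg hxm, if_neg, mul_zero]
          intro h; apply hx; apply Fin.ext; simp only; omega
      · intro h; exact absurd (Finset.mem_univ _) h
    · rw [neg_zero]
      refine Finset.sum_eq_zero fun x _ => ?_
      by_cases hxm : (x : ℕ) < m
      · rw [hP0 x v hxm, zero_mul]
      · simp only [comp, compB]
        rw [dif_neg hxm, if_neg (by omega), mul_zero]
  have key := trans_core m n (n*(d-1)) (ext0 D1) (ext0 D0) hn (by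
      intro x hx y hy
      exact (ext0_apply D1 ⟨x, by omega⟩ ⟨y, by omega⟩).trans (hP1 _ _ hx hy)) (by
      intro x hx y hy
      exact (ext0_apply D0 ⟨x, by omega⟩ ⟨y, by omega⟩).trans (hP0 _ _ hx)) (by
      intro u hu c hc
      exact (ext0_apply D1 ⟨u, hu⟩ ⟨n + c, by omega⟩).trans ((hb ⟨u, hu⟩ c hc).trans
        (ext0_apply D0 ⟨u, hu⟩ ⟨c, by omega⟩).symm)) (by
      intro w hw v hv
      have := hY ⟨w, by omega⟩ ⟨v, by omega⟩
      rw [hc1, hc0, ← sub_eq_add_neg] at this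
      exact eq_of_sub_eq_zero this)
  have fin : ∀ x y, D1 x y = 0 ∧ D0 x y = 0 := by
    intro x y
    rw [← ext0_apply D1, ← ext0_apply D0]
    exact key x x.2 y (by have := y.2; omega)
  exact ⟨fun x y => (fin x y).1, fun x y => (fin x y).2⟩

section
attribute [local instance] Matrix.normedAddCommGroup Matrix.normedSpace

lemma transversal' {m n d : ℕ} (hd : 1 ≤ d) (hn : 0 < n) (P : Pol d m n)
    (U : Set (Pol d m n)) (hU : U ∈ nhds P) :
    ∀ᶠ L in nhds (comp m n d P), ∃ P' ∈ U, StrictEquiv (comp m n d P') L := by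
  let V := (Matrix (Fin (m + n*(d-1))) (Fin (m + n*(d-1))) ℂ × Matrix (Fin (n*d)) (Fin (n*d)) ℂ)
      × Pol d m n
  let xx : V →ₗ[ℂ] Matrix (Fin (m + n*(d-1))) (Fin (m + n*(d-1))) ℂ :=
    LinearMap.fst ℂ _ _ ∘ₗ LinearMap.fst ℂ _ _
  let yy : V →ₗ[ℂ] Matrix (Fin (n*d)) (Fin (n*d)) ℂ :=
    LinearMap.snd ℂ _ _ ∘ₗ LinearMap.fst ℂ _ _
  let pp : V →ₗ[ℂ] Pol d m n := LinearMap.snd ℂ _ _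
  have hmap := map_nhds_action (comp m n d P) xx yy (compLin m n d ∘ₗ pp) 0 (by
    intro D
    obtain ⟨v, hv⟩ := tanC_surj hd hn P D
    refine ⟨v, ?_, ?_⟩
    · rw [← hv]; simp [tanC, xx, yy, pp]; rfl
    · rw [← hv]; simp [tanC, xx, yy, pp]; rfl)
  rw [← hmap, Filter.eventually_map]
  have hpc : Filter.Tendsto (fun v : V => P + pp v) (nhds 0) (nhds P) := by
    have : Continuous (fun v : V => P + pp v) :=
      continuous_const.add (LinearMap.continuous_of_finiteDimensional pp)
    have h := this.tendsto 0
    rw [map_zero, add_zero] at h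
    exact h
  have hev : ∀ᶠ v in nhds (0 : V), P + pp v ∈ U := hpc.eventually hU
  filter_upwards [isUnit_one_add_eventually xx (LinearMap.continuous_of_finiteDimensional _),
    isUnit_one_add_eventually yy (LinearMap.continuous_of_finiteDimensional _), hev] with v hX hY hE
  refine ⟨P + pp v, hE, StrictEquiv.symm' ?_⟩
  refine StrictEquiv.of_eq _ _ hX hY ?_ ?_
  · rw [comp_add]
    simp only [LinearMap.zero_apply, Prod.fst_zero, add_zero, LinearMap.comp_apply, Prod.fst_add]
  · rw [comp_add]
    simp only [LinearMap.zero_apply, Prod.snd_zero, add_zero, LinearMap.comp_apply, Prod.snd_add]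

end

lemma transversal {m n d : ℕ} (hd : 1 ≤ d) (hn : 0 < n) (P : Pol d m n)
    (K : Pencil (m + n*(d-1)) (n*d)) (h : comp m n d P ∈ closure {L | StrictEquiv L K}) :
    P ∈ closure {P' : Pol d m n | StrictEquiv (comp m n d P') K} := by
  rw [mem_closure_iff_nhds]
  intro U hU
  obtain ⟨L, ⟨P', hP', hL⟩, hLK⟩ := mem_closure_iff_nhds.1 h _ (transversal' hd hn P U hU)
  exact ⟨P', hP', hL.trans' hLK⟩

lemma closure_orbit {p q : ℕ} {L L' K : Pencil p q} (h : StrictEquiv L L')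
    (hL : L' ∈ closure {N : Pencil p q | StrictEquiv N K}) :
    L ∈ closure {N : Pencil p q | StrictEquiv N K} := by
  obtain ⟨P, Q, hP, hQ, h1, h2⟩ := h.exists_eq
  let g : Pencil p q → Pencil p q := fun N => (P * N.1 * Q, P * N.2 * Q)
  have hg : Continuous g := by
    refine Continuous.prodMk ?_ ?_
    · exact (continuous_const.matrix_mul continuous_fst).matrix_mul continuous_const
    · exact (continuous_const.matrix_mul continuous_snd).matrix_mul continuous_const
  have e : g L' = L := Prod.ext h1.symm h2.symm
  rw [← e]
  refine closure_mono ?_ (image_closure_subset_closure_image hg ⟨L', hL, rfl⟩)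
  rintro _ ⟨N, hN, rfl⟩
  exact (StrictEquiv.of_eq P Q hP hQ rfl rfl : StrictEquiv (g N) N).trans' hN

/-! ### Rank of the companion form -/

/-- evaluation of a matrix polynomial -/
noncomputable def evalM {m n d : ℕ} (P : Pol d m n) (t : ℂ) : Matrix (Fin m) (Fin n) ℂ :=
  fun i j => ∑ k : Fin (d+1), P k i j * t ^ (k : ℕ)

lemma exists_UV {m n : ℕ} (A : Matrix (Fin m) (Fin n) ℂ) :
    ∃ (U : Matrix (Fin A.rank) (Fin m) ℂ) (V : Matrix (Fin n) (Fin A.rank) ℂ), U * A * V = 1 := by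
  let f := Matrix.toLin' A
  have hr : Module.finrank ℂ (LinearMap.range f) = A.rank := rfl
  let e : LinearMap.range f ≃ₗ[ℂ] (Fin A.rank → ℂ) :=
    (Module.finBasisOfFinrankEq ℂ _ hr).equivFun
  obtain ⟨g, hg⟩ := LinearMap.exists_rightInverse_of_surjective f.rangeRestrict
    (LinearMap.range_rangeRestrict f)
  obtain ⟨h, hh⟩ := LinearMap.exists_leftInverse_of_injective (LinearMap.range f).subtype
    (Submodule.ker_subtype _)
  refine ⟨LinearMap.toMatrix' (e.toLinearMap ∘ₗ h), LinearMap.toMatrix' (g ∘ₗ e.symm.toLinearMap), ?_⟩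
  have hA : A = LinearMap.toMatrix' f := (LinearMap.toMatrix'_toLin' A).symm
  have : LinearMap.toMatrix' (e.toLinearMap ∘ₗ h) * A * LinearMap.toMatrix' (g ∘ₗ e.symm.toLinearMap)
      = LinearMap.toMatrix' ((e.toLinearMap ∘ₗ h) ∘ₗ f ∘ₗ (g ∘ₗ e.symm.toLinearMap)) := by
    rw [LinearMap.toMatrix'_comp, LinearMap.toMatrix'_comp, ← hA, Matrix.mul_assoc]
  rw [this]
  have e2 : (e.toLinearMap ∘ₗ h) ∘ₗ f ∘ₗ (g ∘ₗ e.symm.toLinearMap) = LinearMap.id := by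
    refine LinearMap.ext fun v => ?_
    have h1 : f (g (e.symm v)) = (LinearMap.range f).subtype (e.symm v) := by
      have := LinearMap.congr_fun hg (e.symm v)
      exact congrArg Subtype.val this
    have h2 : h ((LinearMap.range f).subtype (e.symm v)) = e.symm v := LinearMap.congr_fun hh _
    change e (h (f (g (e.symm v)))) = v
    rw [h1, h2, LinearEquiv.apply_symm_apply]
  rw [e2, LinearMap.toMatrix'_id]

lemma rank_eval_le {m n d : ℕ} (P : Pol d m n) (t : ℂ) : (evalM P t).rank ≤ nrank P := by
  obtain ⟨U, V, hUV⟩ := exists_UV (evalM P t)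
  let Mp : Matrix (Fin m) (Fin n) (Polynomial ℂ) := fun i j =>
    ∑ k : Fin (d+1), Polynomial.C (P k i j) * Polynomial.X ^ (k : ℕ)
  have h1 : Mp.map (Polynomial.evalRingHom t) = evalM P t := by
    ext i j
    rw [Matrix.map_apply]
    simp [Mp, evalM, Polynomial.eval_finsetSum]
  have h2 : Mp.map (algebraMap (Polynomial ℂ) (RatFunc ℂ)) = ratMatrix P := by
    ext i j
    rw [Matrix.map_apply]
    simp [Mp, ratMatrix]
  let W := U.map Polynomial.C * Mp * V.map Polynomial.C
  have hW : W.det ≠ 0 := by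
    intro h0
    have h3 := congrArg (Polynomial.evalRingHom t) h0
    rw [RingHom.map_det, map_zero] at h3
    have h4 : (Polynomial.evalRingHom t).mapMatrix W = 1 := by
      rw [RingHom.mapMatrix_apply]
      simp only [W]
      rw [Matrix.map_mul, Matrix.map_mul, h1, ← hUV]
      congr 1
      · congr 1
        ext i j; simp
      · ext i j; simp
    rw [h4, Matrix.det_one] at h3
    exact one_ne_zero h3
  have hW' : (W.map (algebraMap (Polynomial ℂ) (RatFunc ℂ))).det ≠ 0 := by
    intro h0
    apply hW
    apply RatFunc.algebraMap_injective ℂ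
    rw [RingHom.map_det, map_zero]
    exact h0
  have hr := Matrix.rank_of_isUnit _ ((Matrix.isUnit_iff_isUnit_det _).2 (isUnit_iff_ne_zero.2 hW'))
  rw [Fintype.card_fin] at hr
  rw [← hr, nrank, ← h2]
  simp only [W]
  rw [Matrix.map_mul, Matrix.map_mul]
  exact (Matrix.rank_mul_le_left _ _).trans (Matrix.rank_mul_le_right _ _)

/-- block coordinates on the columns, in reversed block order -/
def colEquiv (n d : ℕ) : Fin d × Fin n ≃ Fin (n * d) :=
  (Fin.revPerm.prodCongr (Equiv.refl _)).trans
    (finProdFinEquiv.trans (finCongr (Nat.mul_comm d n)))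

lemma colEquiv_val (n d : ℕ) (k : Fin d) (j : Fin n) :
    (colEquiv n d (k, j) : ℕ) = j + n * (d - 1 - k) := by
  simp [colEquiv, Fin.rev]
  omega

lemma colEquiv_div (n d : ℕ) (k : Fin d) (j : Fin n) :
    (colEquiv n d (k, j) : ℕ) / n = d - 1 - k := by
  rw [colEquiv_val, Nat.add_mul_div_left _ _ (by have := j.2; omega), Nat.div_eq_of_lt j.2, zero_add]

lemma colEquiv_mod (n d : ℕ) (k : Fin d) (j : Fin n) :
    (colEquiv n d (k, j) : ℕ) % n = j := by
  rw [colEquiv_val, Nat.add_mul_mod_self_left, Nat.mod_eq_of_lt j.2]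

/-- the map `x ↦ (t^{d-1} x, …, t x, x)` -/
noncomputable def lift (n d : ℕ) (hn : 0 < n) (t : ℂ) : (Fin n → ℂ) →ₗ[ℂ] (Fin (n*d) → ℂ) where
  toFun x := fun y => t ^ (d - 1 - (y : ℕ) / n) * x ⟨(y : ℕ) % n, Nat.mod_lt _ hn⟩
  map_add' x x' := by ext y; simp [mul_add]
  map_smul' c x := by ext y; simp; ring

lemma lift_apply (n d : ℕ) (hn : 0 < n) (t : ℂ) (x : Fin n → ℂ) (y : Fin (n*d)) :
    lift n d hn t x y = t ^ (d - 1 - (y : ℕ) / n) * x ⟨(y : ℕ) % n, Nat.mod_lt _ hn⟩ := rfl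

lemma lift_colEquiv (n d : ℕ) (hn : 0 < n) (t : ℂ) (x : Fin n → ℂ) (k : Fin d) (j : Fin n) :
    lift n d hn t x (colEquiv n d (k, j)) = t ^ (k : ℕ) * x j := by
  rw [lift_apply]
  congr 1
  · rw [colEquiv_div]; congr 1; omega
  · congr 1; apply Fin.ext; exact colEquiv_mod n d k j

lemma lift_injective (n d : ℕ) (hn : 0 < n) (hd : 1 ≤ d) (t : ℂ) :
    Function.Injective (lift n d hn t) := by
  intro x x' h
  ext j
  have := congrFun h (colEquiv n d (⟨0, hd⟩, j))
  rw [lift_colEquiv, lift_colEquiv] at this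
  simpa using this

lemma nd_eq {n d : ℕ} (hd : 1 ≤ d) : n * d = n + n * (d - 1) := by
  obtain ⟨d, rfl⟩ : ∃ d', d = d' + 1 := ⟨d - 1, by omega⟩
  rw [Nat.add_sub_cancel]; ring

lemma compA_low {m n d : ℕ} (hd : 1 ≤ d) (P : Pol d m n) (z : Fin (n*d) → ℂ)
    (i : Fin (m + n * (d - 1))) (hi : m ≤ (i : ℕ)) (hc : (i : ℕ) - m < n * (d - 1)) :
    (compA m n d P *ᵥ z) i = z ⟨n + (i - m), by have := nd_eq (n := n) hd; omega⟩ := by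
  have hi : ¬ (i : ℕ) < m := by omega
  have hq := nd_eq (n := n) hd
  rw [Matrix.mulVec, dotProduct, Finset.sum_eq_single ⟨n + (i - m), by omega⟩]
  · simp only [compA]
    rw [dif_neg hi, if_pos (by omega), one_mul]
  · intro y _ hy
    simp only [compA]
    rw [dif_neg hi, if_neg, zero_mul]
    intro h; apply hy; apply Fin.ext; simp only; omega
  · intro h; exact absurd (Finset.mem_univ _) h

lemma compB_low {m n d : ℕ} (hd : 1 ≤ d) (P : Pol d m n) (z : Fin (n*d) → ℂ)
    (i : Fin (m + n * (d - 1))) (hi : m ≤ (i : ℕ)) (hc : (i : ℕ) - m < n * (d - 1)) :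
    (compB m n d P *ᵥ z) i = - z ⟨i - m, by have := nd_eq (n := n) hd; omega⟩ := by
  have hi : ¬ (i : ℕ) < m := by omega
  have hq := nd_eq (n := n) hd
  rw [Matrix.mulVec, dotProduct, Finset.sum_eq_single ⟨i - m, by omega⟩]
  · simp only [compB]
    rw [dif_neg hi, if_pos trivial, neg_one_mul]
  · intro y _ hy
    simp only [compB]
    rw [dif_neg hi, if_neg, zero_mul]
    intro h; apply hy; apply Fin.ext; simp only; omega
  · intro h; exact absurd (Finset.mem_univ _) h

lemma lift_mem_ker {m n d : ℕ} (hn : 0 < n) (hd : 1 ≤ d) (P : Pol d m n) (t : ℂ)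
    (x : Fin n → ℂ) (hx : evalM P t *ᵥ x = 0) :
    (t • compA m n d P + compB m n d P) *ᵥ lift n d hn t x = 0 := by
  have hq : n * d = n + n * (d - 1) := by
    obtain ⟨d, rfl⟩ : ∃ d', d = d' + 1 := ⟨d - 1, by omega⟩
    rw [Nat.add_sub_cancel]; ring
  ext i
  rw [Matrix.add_mulVec, Matrix.smul_mulVec, Pi.add_apply, Pi.smul_apply, Pi.zero_apply, smul_eq_mul]
  by_cases hi : (i : ℕ) < m
  · have h1 := congrFun hx ⟨i, hi⟩
    have hB : (compB m n d P *ᵥ lift n d hn t x) i =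
        ∑ k : Fin d, ∑ j, P k.castSucc ⟨i, hi⟩ j * t ^ (k : ℕ) * x j := by
      rw [Matrix.mulVec, dotProduct, ← Equiv.sum_comp (colEquiv n d), Fintype.sum_prod_type]
      refine Finset.sum_congr rfl fun k _ => Finset.sum_congr rfl fun j _ => ?_
      rw [lift_colEquiv, mul_assoc]
      congr 1
      simp only [compB, dif_pos hi, dif_pos hn, colEquiv_mod]
      congr 2
      rw [colEquiv_div]
      omega
    have hA : (compA m n d P *ᵥ lift n d hn t x) i =
        ∑ j, P (Fin.last d) ⟨i, hi⟩ j * t ^ (d - 1) * x j := by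
      rw [Matrix.mulVec, dotProduct, ← Equiv.sum_comp (colEquiv n d), Fintype.sum_prod_type,
        Finset.sum_eq_single ⟨d - 1, by omega⟩]
      · refine Finset.sum_congr rfl fun j _ => ?_
        rw [lift_colEquiv, mul_assoc]
        congr 1
        have hv : (colEquiv n d (⟨d - 1, by omega⟩, j) : ℕ) = j := by
          rw [colEquiv_val]; simp
        simp only [compA, dif_pos hi, hv, dif_pos j.2]
      · intro k _ hk
        refine Finset.sum_eq_zero fun j _ => ?_
        have hv : ¬ (colEquiv n d (k, j) : ℕ) < n := by
          rw [colEquiv_val]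
          have hk' : (k : ℕ) ≠ d - 1 := fun h => hk (Fin.ext h)
          have : n * 1 ≤ n * (d - 1 - k) := Nat.mul_le_mul_left _ (by omega)
          omega
        simp only [compA, dif_pos hi, dif_neg hv, zero_mul]
      · intro h; exact absurd (Finset.mem_univ _) h
    rw [hA, hB]
    have e : (evalM P t *ᵥ x) ⟨i, hi⟩
        = ∑ k : Fin (d+1), ∑ j, P k ⟨i, hi⟩ j * t ^ (k : ℕ) * x j := by
      rw [Matrix.mulVec, dotProduct, Finset.sum_comm]
      refine Finset.sum_congr rfl fun j _ => ?_
      exact Finset.sum_mul _ _ _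
    have h2 := e.symm.trans h1
    rw [Fin.sum_univ_castSucc] at h2
    refine Eq.trans ?_ h2
    rw [add_comm]
    refine congrArg _ ?_
    refine (Finset.mul_sum _ _ _).trans ?_
    refine Finset.sum_congr rfl fun j _ => ?_
    have : t ^ d = t * t ^ (d - 1) := by rw [← pow_succ']; congr 1; omega
    rw [Fin.val_last, this]; ring
  · have hc : (i : ℕ) - m < n * (d - 1) := by have := i.2; omega
    have hA := compA_low hd P (lift n d hn t x) i (by omega) hc
    have hB := compB_low hd P (lift n d hn t x) i (by omega) hc
    rw [hA, hB, lift_apply, lift_apply, ← sub_eq_add_neg, sub_eq_zero]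
    have hdiv : ((i : ℕ) - m) / n < d - 1 := Nat.div_lt_of_lt_mul hc
    simp only [Nat.add_div_left _ hn, Nat.add_mod_left]
    rw [← mul_assoc, ← pow_succ']
    congr 2
    omega

lemma rank_comp_le {m n d r : ℕ} (hn : 0 < n) (hd : 1 ≤ d) (hr : r ≤ n) (P : Pol d m n)
    (h : nrank P ≤ r) (t : ℂ) :
    (t • (comp m n d P).1 + (comp m n d P).2).rank ≤ r + n * (d - 1) := by
  have h1 : (evalM P t).rank ≤ r := (rank_eval_le P t).trans h
  have hq : n * d = n + n * (d - 1) := by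
    obtain ⟨d, rfl⟩ : ∃ d', d = d' + 1 := ⟨d - 1, by omega⟩
    rw [Nat.add_sub_cancel]; ring
  let f := (evalM P t).mulVecLin
  let g := (t • compA m n d P + compB m n d P).mulVecLin
  have hle : (LinearMap.ker f).map (lift n d hn t) ≤ LinearMap.ker g := by
    rintro _ ⟨x, hx, rfl⟩
    exact lift_mem_ker hn hd P t x hx
  have h2 := Submodule.finrank_mono hle
  rw [← (Submodule.equivMapOfInjective (lift n d hn t) (lift_injective n d hn hd t)
    (LinearMap.ker f)).finrank_eq] at h2
  have h3 := LinearMap.finrank_range_add_finrank_ker f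
  have h4 := LinearMap.finrank_range_add_finrank_ker g
  rw [Module.finrank_fin_fun] at h3 h4
  change Module.finrank ℂ (LinearMap.range f) ≤ r at h1
  change Module.finrank ℂ (LinearMap.range g) ≤ r + n * (d - 1)
  omega

/-! ### Lower bound on the right minimal indices of a companion form -/

lemma chain_zero {m n d k : ℕ} (hk : k + 1 < d) (P : Pol d m n) (w : ℕ → Fin (n*d) → ℂ)
    (h0 : compB m n d P *ᵥ w 0 = 0)
    (hs : ∀ i < k, compA m n d P *ᵥ w i = compB m n d P *ᵥ w (i+1))
    (hl : compA m n d P *ᵥ w k = 0) : w 0 = 0 := by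
  have hd : 1 ≤ d := by omega
  have hq := nd_eq (n := n) hd
  have claim : ∀ j ≤ k, ∀ y : Fin (n*d), n * (j+1) ≤ (y : ℕ) → w (k - j) y = 0 := by
    intro j
    induction j with
    | zero =>
      intro _ y hy
      have hy2 := y.2
      have := congrFun hl ⟨m + ((y : ℕ) - n), by omega⟩
      rw [compA_low hd P _ _ (by simp) (by simp only; omega), Pi.zero_apply] at this
      rw [Nat.sub_zero, ← this]
      congr 1
      apply Fin.ext
      simp only
      omega
    | succ j ih =>
      intro hj y hy
      have hy2 := y.2
      have hy3 : n * (j + 1 + 1) = n * (j + 1) + n := by ring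
      have := congrFun (hs (k - (j+1)) (by omega)) ⟨m + ((y : ℕ) - n), by omega⟩
      rw [compA_low hd P _ _ (by simp) (by simp only; omega),
        compB_low hd P _ _ (by simp) (by simp only; omega)] at this
      have e : k - (j+1) + 1 = k - j := by omega
      rw [e, ih (by omega) _ (by simp only; omega), neg_zero] at this
      rw [← this]
      congr 1
      apply Fin.ext
      simp only
      omega
  ext y
  rw [Pi.zero_apply]
  by_cases hy : (y : ℕ) < n * (d - 1)
  · have := congrFun h0 ⟨m + (y : ℕ), by omega⟩
    rw [compB_low hd P _ _ (by simp) (by simp only; omega), Pi.zero_apply, neg_eq_zero] at this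
    rw [← this]
    congr 1
    apply Fin.ext
    simp only
    omega
  · have := claim k le_rfl y (by
      have : n * (k+1) ≤ n * (d-1) := Nat.mul_le_mul_left _ (by omega)
      omega)
    rwa [Nat.sub_self] at this

lemma gen_chain (c₁ c₂ c₃ c₄ e₁ e₂ f₁ f₂ p q : ℕ) (hc : 0 < c₂)
    (hq : c₁ * (e₁+1) + c₂ * (e₂+1) ≤ q) :
    ∃ o, ∃ ho : o + e₂ < q,
      (∀ x, (genPencil c₁ c₂ c₃ c₄ e₁ e₂ f₁ f₂ p q).2 x ⟨o, by omega⟩ = 0) ∧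
      (∀ i, ∀ hi : i < e₂, ∀ x, (genPencil c₁ c₂ c₃ c₄ e₁ e₂ f₁ f₂ p q).1 x ⟨o + i, by omega⟩
        = (genPencil c₁ c₂ c₃ c₄ e₁ e₂ f₁ f₂ p q).2 x ⟨o + (i + 1), by omega⟩) ∧
      (∀ x, (genPencil c₁ c₂ c₃ c₄ e₁ e₂ f₁ f₂ p q).1 x ⟨o + e₂, ho⟩ = 0) := by
  set C := secSize c₁ c₂ c₃ (e₁+1) (e₂+1) f₁ f₂ with hC
  set R := secSize c₁ c₂ c₃ e₁ e₂ (f₁+1) (f₂+1) with hR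
  have hCB : C (c₁+c₂-1) = e₂ + 1 := by
    rw [hC, secSize, if_neg (by omega), if_pos (by omega)]
  have hRB : R (c₁+c₂-1) = e₂ := by
    rw [hR, secSize, if_neg (by omega), if_pos (by omega)]
  have hoff := (off_sec c₁ c₂ c₃ c₄ (e₁+1) (e₂+1) f₁ f₂).1
  rw [← hC] at hoff
  have hlt := off_lt C (a := c₁+c₂-1) (b := c₁+c₂) (by omega)
  have hB : c₁+c₂-1 < c₁+c₂+c₃+c₄ := by omega
  have h1 : ∀ i, i < e₂ + 1 → ∀ x : Fin p, ∀ h : off C (c₁+c₂-1) + i < q,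
      (genPencil c₁ c₂ c₃ c₄ e₁ e₂ f₁ f₂ p q).1 x ⟨off C (c₁+c₂-1) + i, h⟩ =
      if off R (c₁+c₂-1) ≤ (x : ℕ) ∧ (x : ℕ) < off R (c₁+c₂-1) + e₂ then
        (if (x : ℕ) - off R (c₁+c₂-1) = i then (1 : ℂ) else 0) else 0 := by
    intro i hi x h
    have := dsN_col (N := c₁+c₂+c₃+c₄) (ρ := R) (γ := C)
      (ent := fun _ i j => if i = j then 1 else 0) hB (j := i) (by omega) (x : ℕ)
    rw [hRB] at this
    exact this
  have h2 : ∀ i, i < e₂ + 1 → ∀ x : Fin p, ∀ h : off C (c₁+c₂-1) + i < q,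
      (genPencil c₁ c₂ c₃ c₄ e₁ e₂ f₁ f₂ p q).2 x ⟨off C (c₁+c₂-1) + i, h⟩ =
      if off R (c₁+c₂-1) ≤ (x : ℕ) ∧ (x : ℕ) < off R (c₁+c₂-1) + e₂ then
        (if i = (x : ℕ) - off R (c₁+c₂-1) + 1 then (1 : ℂ) else 0) else 0 := by
    intro i hi x h
    have := dsN_col (N := c₁+c₂+c₃+c₄) (ρ := R) (γ := C)
      (ent := fun b i j => if b < c₁ + c₂ then (if j = i+1 then 1 else 0)
       else (if i = j+1 then 1 else 0)) hB (j := i) (by omega) (x : ℕ)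
    rw [hRB] at this
    rw [if_pos (show c₁ + c₂ - 1 < c₁ + c₂ by omega)] at this
    exact this
  refine ⟨off C (c₁+c₂-1), by omega, ?_, ?_, ?_⟩
  · intro x
    refine (h2 0 (by omega) x (by omega)).trans ?_
    rw [if_neg (show ¬ (0 = (x : ℕ) - off R (c₁+c₂-1) + 1) by omega), ite_self]
  · intro i hi x
    rw [h1 i (by omega), h2 (i+1) (by omega)]
    simp only [Nat.add_right_cancel_iff, eq_comm]
  · intro x
    rw [h1 e₂ (by omega)]
    split_ifs <;> first | omega | rfl

lemma comp_index_bound {m n d r b : ℕ} (hr : r < n) (hm : r < m) (hd : 1 ≤ d)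
    (hb : b ≤ r + n * (d-1)) (P : Pol d m n)
    (h : StrictEquiv (comp m n d P) (Kp (m + n*(d-1)) (n*d) (r + n*(d-1)) b)) :
    (n - r) * (d - 1) ≤ b := by
  by_contra hlt
  have hq := nd_eq (n := n) hd
  have hqr : n * d - (r + n*(d-1)) = n - r := by omega
  have hα : b / (n - r) < d - 1 := Nat.div_lt_of_lt_mul (by omega)
  have hmod : b % (n - r) < n - r := Nat.mod_lt _ (by omega)
  have hdm := Nat.div_add_mod b (n - r)
  obtain ⟨S, Q, hS, hQ, h1, h2⟩ := h.exists_eq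
  have hQd := (Matrix.isUnit_iff_isUnit_det Q).1 hQ
  unfold Kp at h1 h2
  rw [hqr] at h1 h2
  set s := b % (n - r) with hs
  set α := b / (n - r) with hα'
  clear_value s α
  clear hs hα'
  obtain ⟨o, ho, g0, gs, gl⟩ := gen_chain s (n - r - s) ((r + n*(d-1) - b) % (m + n*(d-1) - (r + n*(d-1))))
    (m + n*(d-1) - (r + n*(d-1)) - (r + n*(d-1) - b) % (m + n*(d-1) - (r + n*(d-1)))) (α + 1) α
    ((r + n*(d-1) - b) / (m + n*(d-1) - (r + n*(d-1))) + 1)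
    ((r + n*(d-1) - b) / (m + n*(d-1) - (r + n*(d-1))))
    (m + n*(d-1)) (n*d) (by omega) (by
      obtain ⟨u, hu⟩ : ∃ u, n - r = s + u := ⟨n - r - s, by omega⟩
      have e1 : n - r - s = u := by omega
      rw [e1]
      have e2 : s * (α + 1 + 1) + u * (α + 1) = (s + u) * α + s + (s + u) := by ring
      rw [e2, ← hu, hdm]
      omega)
  set K := genPencil s (n - r - s) ((r + n*(d-1) - b) % (m + n*(d-1) - (r + n*(d-1))))
    (m + n*(d-1) - (r + n*(d-1)) - (r + n*(d-1) - b) % (m + n*(d-1) - (r + n*(d-1)))) (α + 1) α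
    ((r + n*(d-1) - b) / (m + n*(d-1) - (r + n*(d-1))) + 1)
    ((r + n*(d-1) - b) / (m + n*(d-1) - (r + n*(d-1))))
    (m + n*(d-1)) (n*d) with hK
  let w : ℕ → Fin (n*d) → ℂ := fun i =>
    if hi : o + i < n*d then Q⁻¹ *ᵥ Pi.single ⟨o + i, hi⟩ 1 else 0
  have hw : ∀ (N : Matrix (Fin (m + n*(d-1))) (Fin (n*d)) ℂ) i (hi : o + i < n*d),
      (S * N * Q) *ᵥ w i = S *ᵥ (fun x => N x ⟨o + i, hi⟩) := by
    intro N i hi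
    simp only [w, dif_pos hi]
    rw [Matrix.mulVec_mulVec, Matrix.mul_assoc, Matrix.mul_nonsing_inv Q hQd, Matrix.mul_one,
      ← Matrix.mulVec_mulVec, Matrix.mulVec_single_one]
    rfl
  have hz := chain_zero (k := α) (by omega) P w
    (by
      change (comp m n d P).2 *ᵥ w 0 = 0
      rw [h2, hw _ 0 (by omega)]
      have : (fun x => K.2 x ⟨o + 0, by omega⟩) = 0 := funext fun x => g0 x
      rw [this, Matrix.mulVec_zero])
    (by
      intro i hi
      change (comp m n d P).1 *ᵥ w i = (comp m n d P).2 *ᵥ w (i+1)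
      rw [h1, h2, hw _ i (by omega), hw _ (i+1) (by omega)]
      congr 1
      exact funext fun x => gs i hi x)
    (by
      change (comp m n d P).1 *ᵥ w α = 0
      rw [h1, hw _ α ho]
      have : (fun x => K.1 x ⟨o + α, ho⟩) = 0 := funext fun x => gl x
      rw [this, Matrix.mulVec_zero])
  have h3 := congrArg (fun v => Q *ᵥ v) hz
  simp only [w, dif_pos (show o + 0 < n * d by omega)] at h3
  rw [Matrix.mulVec_mulVec, Matrix.mul_nonsing_inv Q hQd, Matrix.one_mulVec, Matrix.mulVec_zero] at h3
  have h4 := congrFun h3 ⟨o + 0, by omega⟩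
  simp at h4

lemma Kp_eq_Ga {m n d r b : ℕ} (hr : r < n) (hm : r < m) (hd : 1 ≤ d)
    (hb : b ≤ r + n * (d-1)) (hb' : (n - r) * (d - 1) ≤ b) :
    b - (n - r) * (d - 1) ≤ r * d ∧
    Kp (m + n*(d-1)) (n*d) (r + n*(d-1)) b = Ga m n d r (b - (n - r) * (d - 1)) := by
  obtain ⟨a, rfl⟩ : ∃ a, b = a + (n - r) * (d - 1) := ⟨b - (n - r) * (d - 1), by omega⟩
  rw [Nat.add_sub_cancel]
  have hq := nd_eq (n := n) hd
  have hrd := nd_eq (n := r) hd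
  have hn : n * (d - 1) = (n - r) * (d - 1) + r * (d - 1) := by
    rw [← Nat.add_mul]; congr 1; omega
  refine ⟨by omega, ?_⟩
  unfold Kp Ga
  have e1 : n * d - (r + n*(d-1)) = n - r := by omega
  have e2 : m + n * (d-1) - (r + n*(d-1)) = m - r := by omega
  have e3 : r + n*(d-1) - (a + (n - r) * (d - 1)) = r * d - a := by omega
  have e4 : (a + (n - r) * (d - 1)) % (n - r) = a % (n - r) := Nat.add_mul_mod_self_left _ _ _
  have e5 : (a + (n - r) * (d - 1)) / (n - r) = a / (n - r) + (d - 1) :=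
    Nat.add_mul_div_left _ _ (by omega)
  have e6 : a / (n - r) + (d - 1) + 1 = a / (n - r) + d := by
    generalize a / (n - r) = u; omega
  have e7 : a / (n - r) + (d - 1) = a / (n - r) + d - 1 := by
    generalize a / (n - r) = u; omega
  rw [e1, e2, e3, e4, e5, e6, e7]

/-- For every polynomial `M` of grade `d` with normal rank at most `r`
there is `a ≤ rd` with `closure(O(M)) ⊆ closure(O_a)`. -/
theorem closure_orbit_subset_generic (m n d r : ℕ) (hm : 2 ≤ m) (hn : 2 ≤ n)
    (hd : 1 ≤ d) (hr1 : 1 ≤ r) (hr2 : r ≤ min m n - 1)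
    (M : Pol d m n) (hM : nrank M ≤ r) :
    ∃ a ≤ r * d,
      closure {P : Pol d m n | StrictEquiv (comp m n d P) (comp m n d M)}
        ⊆ closure {P : Pol d m n | StrictEquiv (comp m n d P) (Ga m n d r a)} := by
  have hrn : r < n := by omega
  have hrm : r < m := by omega
  have hq := nd_eq (n := n) hd
  obtain ⟨b, hb, L', hL', hE⟩ := exists_inE (comp m n d M) (ρ := r + n * (d - 1)) (by omega)
    (rank_comp_le (by omega) hd hrn.le M hM)
  obtain ⟨hK, hs⟩ := Kp_props (m + n*(d-1)) (n*d) (r + n*(d-1)) b (by omega) (by omega) hb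
  have hcl := dense_orbit hK hE hs
  have key : ∀ P : Pol d m n, StrictEquiv (comp m n d P) (comp m n d M) →
      P ∈ closure {P' : Pol d m n |
        StrictEquiv (comp m n d P') (Kp (m + n*(d-1)) (n*d) (r + n*(d-1)) b)} := by
    intro P hP
    exact transversal hd (by omega) P _ (closure_orbit (hP.trans' hL'.symm') hcl)
  obtain ⟨P', hP'⟩ := closure_nonempty_iff.1 ⟨M, key M (StrictEquiv.rfl' _)⟩
  have hb' := comp_index_bound hrn hrm hd hb P' hP'
  obtain ⟨ha, he⟩ := Kp_eq_Ga hrn hrm hd hb hb'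
  rw [he] at key
  exact ⟨_, ha, closure_minimal key isClosed_closure⟩

end MPoly
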